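/- arXiv:math/0205183 — 9 statements merged into one kernel-verified Lean document; each statement's English description precedes it below -/
import Mathlib

section
/- For every real α > 0 there exist constants C₁, C₂ > 0 and a threshold P such that for every real p > P and every real a with 0 < a < α·p, one has |ζ(-p, a)/Q(p) − sin(2πa − πp/2)| < C₁·p^(−1/2)·(2πeα)^p + C₂·2^(−p). -/
open Real HurwitzZeta

/-- Real Hurwitz zeta: `hzeta s x` is the value at `s` of the analytic continuation of
`Σ_{r=0}^∞ (x+r)^{-s}` for `x ∈ (0,1]`. -/
noncomputable def hzeta (s x : ℝ) : ℝ := (hurwitzZeta (x : UnitAddCircle) (s : ℂ)).re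

/-- `zetaH p a = ζ(-p, a)` for `a > 0`: writing `a = n + b` with `n ∈ ℕ`, `b ∈ (0,1]`,
this is `hurwitzZeta (-p) b - Σ_{r=0}^{n-1} (r+b)^p`. -/
noncomputable def zetaH (p a : ℝ) : ℝ :=
  hzeta (-p) (a - (⌈a⌉₊ - 1 : ℕ)) -
    ∑ r ∈ Finset.range (⌈a⌉₊ - 1), ((r : ℝ) + (a - (⌈a⌉₊ - 1 : ℕ))) ^ p

/-- `Q p = 2·Γ(1+p)/(2π)^{1+p}`. -/
noncomputable def Q (p : ℝ) : ℝ := 2 * Real.Gamma (1 + p) / (2 * π) ^ (1 + p)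

theorem gamma_lower (p : ℝ) (hp : 0 < p) :
    √p * (Real.exp (-(1/2)) * (p ^ p * Real.exp (-p))) ≤ Real.Gamma (1 + p) := by
  have hsp : 0 < √p := Real.sqrt_pos.mpr hp
  have hsq : √p * √p = p := Real.mul_self_sqrt hp.le
  rw [Real.Gamma_eq_integral (by linarith)]
  have hint := Real.GammaIntegral_convergent (s := 1 + p) (by linarith)
  have hsub : Set.Ioc p (p + √p) ⊆ Set.Ioi 0 := fun x hx => lt_trans hp hx.1
  have h1 : ∫ x in Set.Ioc p (p + √p), Real.exp (-x) * x ^ (1 + p - 1) ≤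
      ∫ x in Set.Ioi 0, Real.exp (-x) * x ^ (1 + p - 1) := by
    apply MeasureTheory.setIntegral_mono_set hint
    · filter_upwards [MeasureTheory.ae_restrict_mem measurableSet_Ioi] with x hx
      have : (0:ℝ) < x := hx
      simp only [Pi.zero_apply]
      positivity
    · exact hsub.eventuallyLE
  refine le_trans ?_ h1
  have h2 : ∫ x in Set.Ioc p (p + √p), (Real.exp (-(1/2)) * (p ^ p * Real.exp (-p))) ≤
      ∫ x in Set.Ioc p (p + √p), Real.exp (-x) * x ^ (1 + p - 1) := by
    apply MeasureTheory.setIntegral_mono_on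
    · exact MeasureTheory.integrableOn_const (by simp)
    · exact hint.mono_set hsub
    · exact measurableSet_Ioc
    · intro x hx
      have hx0 : 0 < x := lt_trans hp hx.1
      rw [Real.rpow_def_of_pos hp, Real.rpow_def_of_pos hx0, ← Real.exp_add, ← Real.exp_add,
        ← Real.exp_add, Real.exp_le_exp]
      have hx1 := hx.1
      have hx2 := hx.2
      set u := (x - p) / p with hu
      have hu0 : 0 ≤ u := by apply div_nonneg <;> linarith
      have hxu : x = p * (1 + u) := by rw [hu]; field_simp; ring
      have hup : p * u ≤ √p := by rw [hu]; field_simp; linarith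
      have hu2 : p * u ^ 2 ≤ 1 := by
        have : (p * u) * (p * u) ≤ √p * √p :=
          mul_le_mul hup hup (by positivity) (by positivity)
        rw [hsq] at this
        have : p * (p * u ^ 2) ≤ p * 1 := by nlinarith
        exact le_of_mul_le_mul_left this hp
      have hlog : u - u ^ 2 / 2 ≤ Real.log (1 + u) := by
        refine le_trans ?_ (Real.le_log_one_add_of_nonneg hu0)
        rw [le_div_iff₀ (by linarith)]
        nlinarith [pow_nonneg hu0 3]
      have hlx : Real.log x = Real.log p + Real.log (1 + u) := by
        rw [hxu, Real.log_mul hp.ne' (by linarith)]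
      rw [hlx, hxu]
      nlinarith [mul_le_mul_of_nonneg_left hlog hp.le]
  refine le_trans (le_of_eq ?_) h2
  rw [MeasureTheory.setIntegral_const]
  simp [MeasureTheory.measureReal_def, hsp.le]

theorem hzeta_hasSum (p b : ℝ) (hp : 0 < p) :
    HasSum (fun n : ℕ => Q p * (Real.sin (2 * π * b * n - π * p / 2) / (n : ℝ) ^ (1 + p)))
      (hzeta (-p) b) := by
  set s : ℂ := ((1 + p : ℝ) : ℂ) with hs
  have hre : 1 < s.re := by simp [hs, hp]
  have h1 := (hasSum_expZeta_of_one_lt_re b hre).mul_left (Complex.exp (-π * Complex.I * s / 2))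
  have h2 := (hasSum_expZeta_of_one_lt_re (-b) hre).mul_left (Complex.exp (π * Complex.I * s / 2))
  have h3 := ((h1.add h2).mul_left ((2 * π : ℂ) ^ (-s) * Complex.Gamma s))
  have hE : hurwitzZeta (b : UnitAddCircle) ((-p : ℝ) : ℂ) = (2 * π : ℂ) ^ (-s) * Complex.Gamma s *
      (Complex.exp (-π * Complex.I * s / 2) * expZeta b s +
        Complex.exp (π * Complex.I * s / 2) * expZeta ((-b : ℝ) : UnitAddCircle) s) := by
    have := hurwitzZeta_one_sub (b : UnitAddCircle) (s := s) ?_ ?_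
    · have h0 : ((-p : ℝ) : ℂ) = 1 - s := by rw [hs]; push_cast; ring
      rw [h0, this]
      push_cast
      rfl
    · intro n h
      have := congrArg Complex.re h
      simp [hs] at this
      have hn : (0:ℝ) ≤ n := n.cast_nonneg
      linarith
    · right
      intro h
      have := congrArg Complex.re h
      simp [hs] at this
      linarith
  rw [← hE] at h3
  have h4 := Complex.hasSum_re h3
  refine h4.congr_fun ?_
  intro n
  have hpi : (0:ℝ) ≤ 2 * π := by positivity
  have hA : (2 * π : ℂ) ^ (-s) = (((2 * π) ^ (-(1 + p)) : ℝ) : ℂ) := by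
    rw [Complex.ofReal_cpow hpi]; simp [hs]
  have hG : Complex.Gamma s = ((Real.Gamma (1 + p) : ℝ) : ℂ) := by
    rw [hs, Complex.Gamma_ofReal]
  have hn : (n : ℂ) ^ s = (((n : ℝ) ^ (1 + p) : ℝ) : ℂ) := by
    rw [Complex.ofReal_cpow n.cast_nonneg]; simp [hs]
  have hsin : ((Real.sin (2 * π * b * n - π * p / 2) : ℝ) : ℂ) * 2 =
      Complex.exp (-π * Complex.I * s / 2) * Complex.exp (2 * π * Complex.I * b * n) +
      Complex.exp (π * Complex.I * s / 2) * Complex.exp (2 * π * Complex.I * (-b : ℝ) * n) := by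
    have : Real.sin (2 * π * b * n - π * p / 2) =
        Real.cos (2 * π * b * n - π * (1 + p) / 2) := by
      rw [← Real.cos_sub_pi_div_two]; congr 1; ring
    rw [this, Complex.ofReal_cos, Complex.cos, ← Complex.exp_add, ← Complex.exp_add, div_mul_cancel₀ _ two_ne_zero]
    congr 2 <;> (rw [hs]; push_cast; ring)
  have : (2 * π : ℂ) ^ (-s) * Complex.Gamma s *
      (Complex.exp (-π * Complex.I * s / 2) * (Complex.exp (2 * π * Complex.I * b * n) / n ^ s) +
      Complex.exp (π * Complex.I * s / 2) *
        (Complex.exp (2 * π * Complex.I * (-b : ℝ) * n) / n ^ s)) =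
      ((Q p * (Real.sin (2 * π * b * n - π * p / 2) / (n : ℝ) ^ (1 + p)) : ℝ) : ℂ) := by
    rw [← mul_div_assoc, ← mul_div_assoc, ← add_div, ← hsin, hA, hG, hn, Q,
      Real.rpow_neg hpi]
    push_cast
    ring
  rw [this, Complex.ofReal_re]

theorem hzeta_bound (p b : ℝ) (hp : 1 ≤ p) :
    |hzeta (-p) b - Q p * Real.sin (2 * π * b - π * p / 2)| ≤
      Q p * (2 * (∑' n : ℕ, 1 / ((n : ℝ) + 2) ^ 2) * 2 ^ (-p)) := by
  have hQ : 0 < Q p := by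
    unfold Q
    have := Real.Gamma_pos_of_pos (s := 1 + p) (by linarith)
    positivity
  have h := hzeta_hasSum p b (by linarith)
  have h2 := (hasSum_nat_add_iff' 2).mpr h
  simp only [Finset.sum_range_succ, Finset.sum_range_zero] at h2
  rw [Nat.cast_zero, Real.zero_rpow (by linarith), div_zero, mul_zero, Nat.cast_one,
    Real.one_rpow, div_one, mul_one, zero_add, zero_add] at h2
  have hs : Summable (fun n : ℕ => 1 / ((n : ℝ) + 2) ^ 2) := by
    have := (summable_nat_add_iff 2).mpr (Real.summable_one_div_nat_pow.mpr one_lt_two)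
    simpa using this
  have hg : HasSum (fun n : ℕ => Q p * (2 * (1 / ((n : ℝ) + 2) ^ 2) * 2 ^ (-p)))
      (Q p * (2 * (∑' n : ℕ, 1 / ((n : ℝ) + 2) ^ 2) * 2 ^ (-p))) :=
    ((hs.hasSum.mul_left 2).mul_right _).mul_left _
  rw [← Real.norm_eq_abs, ← h2.tsum_eq]
  apply tsum_of_norm_bounded hg
  intro n
  have hn : (0:ℝ) ≤ n := n.cast_nonneg
  rw [Real.norm_eq_abs, abs_mul, abs_of_pos hQ, abs_div]
  push_cast
  have hpos : (0:ℝ) < ((n:ℝ) + 2) ^ (1 + p) := by positivity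
  rw [abs_of_pos hpos]
  apply mul_le_mul_of_nonneg_left _ hQ.le
  have h3 : |Real.sin (2 * π * b * (n + 2) - π * p / 2)| / ((n:ℝ) + 2) ^ (1 + p) ≤
      1 / ((n:ℝ) + 2) ^ (1 + p) := by
    gcongr
    exact Real.abs_sin_le_one _
  refine h3.trans ?_
  have h4 : ((n:ℝ) + 2) ^ (1 + p) = ((n:ℝ) + 2) ^ 2 * ((n:ℝ) + 2) ^ (p - 1) := by
    rw [← Real.rpow_natCast, ← Real.rpow_add (by positivity)]
    congr 1; push_cast; ring
  have h5 : (2:ℝ) ^ (p - 1) ≤ ((n:ℝ) + 2) ^ (p - 1) :=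
    Real.rpow_le_rpow (by norm_num) (by linarith) (by linarith)
  have h6 : 2 * (1 / ((n : ℝ) + 2) ^ 2) * 2 ^ (-p) = 1 / (((n : ℝ) + 2) ^ 2 * 2 ^ (p - 1)) := by
    rw [Real.rpow_neg (by norm_num), Real.rpow_sub_one (by norm_num)]
    field_simp
  rw [h4, h6]
  gcongr

theorem sum_bound (α p a : ℝ) (hα : 0 < α) (hp : 1 ≤ p) (ha : 0 < a) (hap : a < α * p) :
    ∑ r ∈ Finset.range (⌈a⌉₊ - 1), ((r : ℝ) + (a - (⌈a⌉₊ - 1 : ℕ))) ^ p ≤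
      (α * p) ^ p * (1 - Real.exp (-(1 / α)))⁻¹ := by
  have hp0 : 0 < p := by linarith
  set n := ⌈a⌉₊ - 1 with hn
  have hna : (n : ℝ) < a := by
    rw [← Nat.lt_ceil]
    have := Nat.ceil_pos.mpr ha
    omega
  have hq0 := (Real.exp_pos (-(1 / α))).le
  have hq1 : Real.exp (-(1 / α)) < 1 := by
    rw [Real.exp_lt_one_iff]
    have : 0 < 1 / α := by positivity
    linarith
  rw [← Finset.sum_range_reflect]
  have : ∀ j ∈ Finset.range n, (((n - 1 - j : ℕ) : ℝ) + (a - n)) ^ p ≤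
      (α * p) ^ p * Real.exp (-(1 / α)) ^ j := by
    intro j hj
    rw [Finset.mem_range] at hj
    have hc : ((n - 1 - j : ℕ) : ℝ) = n - 1 - j := by
      rw [Nat.cast_sub (by omega), Nat.cast_sub (by omega)]; simp
    have hjn : (j : ℝ) + 1 ≤ n := by exact_mod_cast hj
    rw [hc]
    have hj0 : (0:ℝ) ≤ j := j.cast_nonneg
    have h1 : (n:ℝ) - 1 - j + (a - n) ≤ (α * p) * Real.exp (- (j / (α * p))) := by
      have hαp : 0 < α * p := by positivity
      have := Real.add_one_le_exp (- (j / (α * p)))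
      have h2 := mul_le_mul_of_nonneg_left this hαp.le
      have h3 : α * p * (-(j / (α * p)) + 1) = α * p - j := by field_simp; ring
      linarith
    refine (Real.rpow_le_rpow (by linarith) h1 hp0.le).trans (le_of_eq ?_)
    rw [Real.mul_rpow (by positivity) (by positivity), ← Real.exp_mul, ← Real.exp_nat_mul]
    congr 2
    field_simp
  refine (Finset.sum_le_sum this).trans ?_
  rw [← Finset.mul_sum]
  apply mul_le_mul_of_nonneg_left _ (by positivity)
  rw [← tsum_geometric_of_lt_one hq0 hq1]
  exact (summable_geometric_of_lt_one hq0 hq1).sum_le_tsum _ (fun i _ => by positivity)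

theorem stmt_0 (α : ℝ) (hα : 0 < α) :
    ∃ C₁ C₂ P : ℝ, 0 < C₁ ∧ 0 < C₂ ∧
      ∀ p : ℝ, P < p → ∀ a : ℝ, 0 < a → a < α * p →
        |zetaH p a / Q p - Real.sin (2 * π * a - π * p / 2)| <
          C₁ * p ^ (-(1 : ℝ) / 2) * (2 * π * Real.exp 1 * α) ^ p + C₂ * 2 ^ (-p) := by
  have hq1 : Real.exp (-(1 / α)) < 1 := by
    rw [Real.exp_lt_one_iff]
    have : 0 < 1 / α := by positivity
    linarith
  set K := (1 - Real.exp (-(1 / α)))⁻¹ with hK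
  have hK0 : 0 < K := inv_pos.mpr (by linarith)
  set T := ∑' n : ℕ, 1 / ((n : ℝ) + 2) ^ 2 with hT
  have hT0 : 0 ≤ T := tsum_nonneg (fun n => by positivity)
  refine ⟨π * Real.exp (1/2) * K, 2 * T + 1, 1, by positivity, by positivity, ?_⟩
  intro p hp a ha hap
  have hp0 : 0 < p := by linarith
  have hG := Real.Gamma_pos_of_pos (s := 1 + p) (by linarith)
  have hQ : 0 < Q p := by
    unfold Q
    positivity
  have hb := hzeta_bound p (a - (⌈a⌉₊ - 1 : ℕ)) hp.le
  have hs := sum_bound α p a hα hp.le ha hap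
  have hs0 : 0 ≤ ∑ r ∈ Finset.range (⌈a⌉₊ - 1), ((r : ℝ) + (a - (⌈a⌉₊ - 1 : ℕ))) ^ p := by
    have : ((⌈a⌉₊ - 1 : ℕ) : ℝ) < a := by
      rw [← Nat.lt_ceil]
      have := Nat.ceil_pos.mpr ha
      omega
    apply Finset.sum_nonneg
    intro r _
    have : (0:ℝ) ≤ r := r.cast_nonneg
    apply Real.rpow_nonneg
    linarith
  have hsin : Real.sin (2 * π * (a - (⌈a⌉₊ - 1 : ℕ)) - π * p / 2) =
      Real.sin (2 * π * a - π * p / 2) := by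
    rw [← Real.sin_sub_nat_mul_two_pi (2 * π * a - π * p / 2) (⌈a⌉₊ - 1)]
    congr 1; ring
  rw [hsin, ← hT] at hb
  rw [← hK] at hs
  unfold zetaH
  set Z := hzeta (-p) (a - (⌈a⌉₊ - 1 : ℕ))
  set S := ∑ r ∈ Finset.range (⌈a⌉₊ - 1), ((r : ℝ) + (a - (⌈a⌉₊ - 1 : ℕ))) ^ p
  set σ := Real.sin (2 * π * a - π * p / 2)
  -- main estimate for the finite sum
  have hmain : (α * p) ^ p * K ≤ Q p *
      (π * Real.exp (1/2) * K * p ^ (-(1 : ℝ) / 2) * (2 * π * Real.exp 1 * α) ^ p) := by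
    have hg := gamma_lower p hp0
    have hQl : 2 * (√p * (Real.exp (-(1/2)) * (p ^ p * Real.exp (-p)))) / (2 * π) ^ (1 + p)
        ≤ Q p := by
      unfold Q; gcongr
    refine le_trans (le_of_eq ?_) (mul_le_mul_of_nonneg_right hQl (by positivity))
    have e1 : p ^ (-(1 : ℝ) / 2) = (√p)⁻¹ := by
      rw [Real.sqrt_eq_rpow, ← Real.rpow_neg hp0.le]; congr 1; ring
    have e2 : (2 * π * Real.exp 1 * α) ^ p = (2 * π) ^ p * Real.exp p * α ^ p := by
      rw [Real.mul_rpow (by positivity) hα.le, Real.mul_rpow (by positivity) (by positivity),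
        ← Real.exp_mul, one_mul]
    have e3 : (2 * π) ^ (1 + p) = 2 * π * (2 * π) ^ p := by
      rw [Real.rpow_add (by positivity), Real.rpow_one]
    rw [e1, e2, e3, Real.mul_rpow hα.le hp0.le, Real.exp_neg, Real.exp_neg]
    have : √p ≠ 0 := (Real.sqrt_pos.mpr hp0).ne'
    have : (2 * π) ^ p ≠ 0 := by positivity
    field_simp
  have h2p : (0:ℝ) < 2 ^ (-p) := by positivity
  have : (Z - S) / Q p - σ = (Z - Q p * σ - S) / Q p := by field_simp; ring
  rw [this, abs_div, abs_of_pos hQ, div_lt_iff₀ hQ]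
  have h1 := abs_sub (Z - Q p * σ) S
  rw [abs_of_nonneg hs0] at h1
  have := mul_pos hQ h2p
  linarith
end

section
/- For every ε > 0 there exists a threshold P such that for every real p > P and every real a with 0 < a < p/(2πe), one has |ζ(-p, a)/Q(p) − sin(2πa − πp/2)| < ε. In other words, ζ(-p,a)/Q(p) = sin(2πa − πp/2) + o(1) as p → ∞, uniformly on the interval 0 < a < p/(2πe). -/
open Real HurwitzZeta

theorem aux_tail (p b : ℝ) (hp : 1 ≤ p) :
    ‖expZeta (b : UnitAddCircle) ((1 + p : ℝ) : ℂ) - Complex.exp (2 * π * Complex.I * b)‖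
      ≤ (∑' n : ℕ, 1 / ((n : ℝ) + 2) ^ 2) * (1 / 2 : ℝ) ^ (p - 1) := by
  have h := hasSum_expZeta_of_one_lt_re b (s := ((1 + p : ℝ) : ℂ))
    (by rw [Complex.ofReal_re]; linarith)
  have h2 := (hasSum_nat_add_iff' 2).mpr h
  have hs1 : ((1 + p : ℝ) : ℂ) ≠ 0 := by
    rw [Complex.ofReal_ne_zero]; linarith
  have h3 : ∑ i ∈ Finset.range 2, Complex.exp (2 * π * Complex.I * b * (i : ℕ)) /
      ((i : ℕ) : ℂ) ^ ((1 + p : ℝ) : ℂ) = Complex.exp (2 * π * Complex.I * b) := by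
    rw [Finset.sum_range_succ, Finset.sum_range_one, Nat.cast_zero, Complex.zero_cpow hs1]
    simp
  rw [h3] at h2
  have hsum : Summable (fun n : ℕ => 1 / ((n : ℝ) + 2) ^ 2) := by
    have := (summable_nat_add_iff 2).mpr (Real.summable_one_div_nat_pow.mpr (one_lt_two))
    simpa using this
  refine h2.norm_le_of_bounded (hsum.hasSum.mul_right _) ?_
  intro n
  have hn : (0 : ℝ) < (n : ℝ) + 2 := by positivity
  rw [norm_div]
  have e1 : ‖Complex.exp (2 * π * Complex.I * b * ((n + 2 : ℕ) : ℂ))‖ = 1 := by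
    rw [Complex.norm_exp]
    simp
  have e2 : ‖(((n + 2 : ℕ) : ℂ)) ^ ((1 + p : ℝ) : ℂ)‖ = ((n : ℝ) + 2) ^ (1 + p) := by
    rw [Complex.norm_natCast_cpow_of_pos (by omega), Complex.ofReal_re]
    push_cast; rfl
  rw [e1, e2, show 1 + p = 2 + (p - 1) by ring, Real.rpow_add hn,
    Real.div_rpow (by norm_num) (by norm_num), Real.one_rpow, Real.rpow_two, div_mul_div_comm,
    one_mul]
  have : (2 : ℝ) ^ (p - 1) ≤ ((n : ℝ) + 2) ^ (p - 1) :=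
    Real.rpow_le_rpow (by norm_num) (by linarith [(Nat.cast_nonneg n : (0 : ℝ) ≤ n)])
      (by linarith)
  gcongr

theorem aux_hz (p b : ℝ) (hp : 1 ≤ p) :
    |hzeta (-p) b / Q p - Real.sin (2 * π * b - π * p / 2)|
      ≤ (∑' n : ℕ, 1 / ((n : ℝ) + 2) ^ 2) * (1 / 2 : ℝ) ^ (p - 1) := by
  set T := (∑' n : ℕ, 1 / ((n : ℝ) + 2) ^ 2) * (1 / 2 : ℝ) ^ (p - 1) with hT
  have hX := aux_tail p b hp
  have hY := aux_tail p (-b) hp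
  rw [← hT] at hX hY
  have hΓ : 0 < Real.Gamma (1 + p) := Real.Gamma_pos_of_pos (by linarith)
  have hpow : 0 < (2 * π) ^ (1 + p) := Real.rpow_pos_of_pos (by positivity) _
  have hQ : 0 < Q p := by unfold Q; positivity
  have hfe := hurwitzZeta_one_sub (b : UnitAddCircle) (s := ((1 + p : ℝ) : ℂ))
    (by
      intro n h
      have := congrArg Complex.re h
      simp at this
      linarith [(Nat.cast_nonneg n : (0 : ℝ) ≤ n)])
    (Or.inr (by
      intro h
      have := congrArg Complex.re h
      simp at this
      linarith))
  rw [show (1 : ℂ) - ((1 + p : ℝ) : ℂ) = ((-p : ℝ) : ℂ) by push_cast; ring] at hfe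
  have hcoef : (2 * π : ℂ) ^ (-((1 + p : ℝ) : ℂ)) * Complex.Gamma ((1 + p : ℝ) : ℂ)
      = ((Q p / 2 : ℝ) : ℂ) := by
    rw [Complex.Gamma_ofReal, ← Complex.ofReal_neg,
      show (2 * π : ℂ) = ((2 * π : ℝ) : ℂ) by push_cast; rfl,
      ← Complex.ofReal_cpow (by positivity), ← Complex.ofReal_mul]
    congr 1
    rw [Real.rpow_neg (by positivity)]
    unfold Q
    field_simp
  rw [hcoef] at hfe
  rw [show (-(b : UnitAddCircle)) = ((-b : ℝ) : UnitAddCircle) by simp] at hfe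
  set X := expZeta (b : UnitAddCircle) ((1 + p : ℝ) : ℂ)
  set Y := expZeta ((-b : ℝ) : UnitAddCircle) ((1 + p : ℝ) : ℂ)
  set u := Complex.exp (-π * Complex.I * ((1 + p : ℝ) : ℂ) / 2) with hu
  set v := Complex.exp (π * Complex.I * ((1 + p : ℝ) : ℂ) / 2) with hv
  have hun : ‖u‖ = 1 := by rw [hu, Complex.norm_exp]; simp
  have hvn : ‖v‖ = 1 := by rw [hv, Complex.norm_exp]; simp
  have hz : hzeta (-p) b / Q p = ((u * X + v * Y) / 2).re := by
    unfold hzeta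
    rw [hfe, Complex.re_ofReal_mul, show (u * X + v * Y) / 2 = ((1 / 2 : ℝ) : ℂ) * (u * X + v * Y) by
      push_cast; ring, Complex.re_ofReal_mul]
    field_simp
  have hsin : Real.sin (2 * π * b - π * p / 2) =
      ((u * Complex.exp (2 * π * Complex.I * b) +
        v * Complex.exp (2 * π * Complex.I * ((-b : ℝ) : ℂ))) / 2).re := by
    have : Real.sin (2 * π * b - π * p / 2) = Real.cos (2 * π * b - π * (1 + p) / 2) := by
      rw [← Real.cos_sub_pi_div_two]; congr 1; ring
    rw [this, ← Complex.ofReal_re (Real.cos _), Complex.ofReal_cos, Complex.cos, hu, hv,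
      ← Complex.exp_add, ← Complex.exp_add]
    congr 4 <;> · push_cast; ring
  rw [hz, hsin, ← Complex.sub_re]
  refine (Complex.abs_re_le_norm _).trans ?_
  rw [show (u * X + v * Y) / 2 - (u * Complex.exp (2 * π * Complex.I * b) +
        v * Complex.exp (2 * π * Complex.I * ((-b : ℝ) : ℂ))) / 2 =
      (u * (X - Complex.exp (2 * π * Complex.I * b)) +
        v * (Y - Complex.exp (2 * π * Complex.I * ((-b : ℝ) : ℂ)))) / 2 by ring, norm_div]
  have := norm_add_le (u * (X - Complex.exp (2 * π * Complex.I * b)))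
        (v * (Y - Complex.exp (2 * π * Complex.I * ((-b : ℝ) : ℂ))))
  rw [norm_mul, norm_mul, hun, hvn] at this
  rw [show ‖(2 : ℂ)‖ = 2 by simp]
  linarith

theorem aux_sum (p b : ℝ) (hp : 1 ≤ p) (hb : 0 < b) (n : ℕ) (hn : (n : ℝ) + b ≤ p) :
    ∑ r ∈ Finset.range n, ((r : ℝ) + b) ^ p ≤ ((n : ℝ) + b) ^ p := by
  induction n with
  | zero => simp; positivity
  | succ m ih =>
    push_cast at hn
    have hm : 0 < (m : ℝ) + b := by positivity
    have h1 := ih (by linarith)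
    rw [Finset.sum_range_succ]
    have h2 := one_add_mul_self_le_rpow_one_add (s := 1 / ((m : ℝ) + b))
      (by have : 0 < 1 / ((m : ℝ) + b) := by positivity
          linarith) hp
    have h3 : 1 ≤ p * (1 / ((m : ℝ) + b)) := by
      rw [mul_one_div, le_div_iff₀ hm]; linarith
    have h4 : (((m + 1 : ℕ) : ℝ) + b) ^ p = ((m : ℝ) + b) ^ p * (1 + 1 / ((m : ℝ) + b)) ^ p := by
      rw [← Real.mul_rpow hm.le (by positivity)]
      congr 1
      push_cast
      field_simp
      ring
    rw [h4]
    have h5 : 0 < ((m : ℝ) + b) ^ p := by positivity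
    nlinarith

theorem aux_gamma (p : ℝ) (hp : 1 ≤ p) :
    √p * ((p / Real.exp 1) ^ p * Real.exp (-1)) ≤ Real.Gamma (1 + p) := by
  have hp0 : 0 < p := by linarith
  rw [Real.Gamma_eq_integral (by linarith)]
  have hint := Real.GammaIntegral_convergent (s := 1 + p) (by linarith)
  have hsub : Set.Ioc p (p + √p) ⊆ Set.Ioi 0 := fun x hx => hp0.trans hx.1
  have hc : ∫ x in Set.Ioc p (p + √p), ((p / Real.exp 1) ^ p * Real.exp (-1)) =
      √p * ((p / Real.exp 1) ^ p * Real.exp (-1)) := by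
    rw [MeasureTheory.setIntegral_const]
    simp [MeasureTheory.measureReal_def, Real.volume_Ioc, ENNReal.toReal_ofReal (Real.sqrt_nonneg p)]
  rw [← hc]
  calc _ ≤ ∫ x in Set.Ioc p (p + √p), Real.exp (-x) * x ^ (1 + p - 1) := by
        refine MeasureTheory.setIntegral_mono_on
          (MeasureTheory.integrableOn_const (by simp)) (hint.mono_set hsub)
          measurableSet_Ioc ?_
        intro x hx
        have hx0 : 0 < x := hsub hx
        rw [show 1 + p - 1 = p by ring, Real.rpow_def_of_pos (by positivity),
          Real.rpow_def_of_pos hx0, ← Real.exp_add, ← Real.exp_add, Real.exp_le_exp,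
          Real.log_div hp0.ne' (Real.exp_pos 1).ne', Real.log_exp]
        set u := (x - p) / p with hu
        have hu0 : 0 ≤ u := div_nonneg (by linarith [hx.1]) hp0.le
        have hxu : x = p * (1 + u) := by rw [hu]; field_simp; ring
        have hl := Real.le_log_one_add_of_nonneg hu0
        have hl2 : u - u ^ 2 ≤ 2 * u / (u + 2) := by
          rw [le_div_iff₀ (by linarith)]
          nlinarith [pow_nonneg hu0 3, pow_nonneg hu0 2]
        have hpu : p * u ≤ √p := by have := hx.2; rw [hxu] at this; linarith
        have hpu2 : p * u ^ 2 ≤ 1 := by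
          have h1 : (p * u) ^ 2 ≤ p := by
            calc (p * u) ^ 2 ≤ √p ^ 2 := by gcongr
              _ = p := Real.sq_sqrt hp0.le
          have h2 : p * (p * u ^ 2) ≤ p * 1 := by linarith
          exact le_of_mul_le_mul_left h2 hp0
        have hlx : Real.log x = Real.log p + Real.log (1 + u) := by
          rw [hxu, Real.log_mul hp0.ne' (by positivity)]
        rw [hlx]
        have h6 : p * (u - u ^ 2) ≤ p * Real.log (1 + u) := by
          gcongr; linarith
        rw [hxu] 
        nlinarith
    _ ≤ _ := by
        refine MeasureTheory.setIntegral_mono_set hint ?_ hsub.eventuallyLE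
        filter_upwards [MeasureTheory.ae_restrict_mem measurableSet_Ioi] with x hx
        have : 0 < x := hx
        simp only [Pi.zero_apply]
        positivity

theorem aux_ratio (p a : ℝ) (hp : 1 ≤ p) (ha : 0 < a) (hap : a < p / (2 * π * Real.exp 1)) :
    a ^ p / Q p ≤ π * Real.exp 1 / √p := by
  have hp0 : 0 < p := by linarith
  have hg := aux_gamma p hp
  have hs : 0 < √p := Real.sqrt_pos.mpr hp0
  have hE : 0 < (p / Real.exp 1) ^ p := by positivity
  have h2 : 0 < (2 * π) ^ p := by positivity
  have hΓ : 0 < Real.Gamma (1 + p) := Real.Gamma_pos_of_pos (by linarith)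
  have h1 : a ^ p ≤ (p / Real.exp 1) ^ p / (2 * π) ^ p := by
    rw [← Real.div_rpow (by positivity) (by positivity)]
    refine Real.rpow_le_rpow ha.le ?_ hp0.le
    rw [div_div, mul_comm (Real.exp 1)]; exact hap.le
  have hQ : Q p = Real.Gamma (1 + p) / (π * (2 * π) ^ p) := by
    unfold Q
    rw [Real.rpow_add (by positivity), Real.rpow_one]
    field_simp
  rw [hQ, div_div_eq_mul_div, div_le_div_iff₀ hΓ hs]
  rw [le_div_iff₀ h2] at h1
  rw [Real.exp_neg] at hg
  have h3 : √p * (p / Real.exp 1) ^ p ≤ Real.exp 1 * Real.Gamma (1 + p) := by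
    have := mul_le_mul_of_nonneg_left hg (Real.exp_pos 1).le
    refine le_trans (le_of_eq ?_) this
    field_simp
  calc a ^ p * (π * (2 * π) ^ p) * √p = π * √p * (a ^ p * (2 * π) ^ p) := by ring
    _ ≤ π * √p * (p / Real.exp 1) ^ p := by gcongr
    _ = π * (√p * (p / Real.exp 1) ^ p) := by ring
    _ ≤ π * (Real.exp 1 * Real.Gamma (1 + p)) := by gcongr
    _ = _ := by ring

theorem stmt_1 (ε : ℝ) (hε : 0 < ε) :
    ∃ P : ℝ, ∀ p : ℝ, P < p → ∀ a : ℝ, 0 < a → a < p / (2 * π * Real.exp 1) →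
      |zetaH p a / Q p - Real.sin (2 * π * a - π * p / 2)| < ε := by
  have l1 : Filter.Tendsto (fun p : ℝ => (∑' n : ℕ, 1 / ((n : ℝ) + 2) ^ 2) * (1 / 2 : ℝ) ^ (p - 1))
      Filter.atTop (nhds 0) := by
    have := (tendsto_rpow_atTop_of_base_lt_one (1 / 2 : ℝ) (by norm_num) (by norm_num)).comp
      (Filter.tendsto_atTop_add_const_right Filter.atTop (-1 : ℝ) Filter.tendsto_id)
    have h := this.const_mul (∑' n : ℕ, 1 / ((n : ℝ) + 2) ^ 2)
    rw [mul_zero] at h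
    exact h
  have l2 : Filter.Tendsto (fun p : ℝ => π * Real.exp 1 / √p) Filter.atTop (nhds 0) :=
    Filter.Tendsto.const_div_atTop Real.tendsto_sqrt_atTop _
  obtain ⟨P, hP⟩ := Filter.eventually_atTop.mp
    ((l1.eventually (gt_mem_nhds (half_pos hε))).and (l2.eventually (gt_mem_nhds (half_pos hε))))
  refine ⟨max P 1, fun p hpP a ha hap => ?_⟩
  have hp : 1 ≤ p := ((le_max_right _ _).trans_lt hpP).le
  obtain ⟨e1, e2⟩ := hP p ((le_max_left _ _).trans_lt hpP).le
  have hΓ : 0 < Real.Gamma (1 + p) := Real.Gamma_pos_of_pos (by linarith)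
  have hQ : 0 < Q p := by unfold Q; positivity
  have hr := aux_ratio p a hp ha hap
  have hap' : a ≤ p := by
    refine hap.le.trans (div_le_self (by linarith) ?_)
    have := Real.pi_gt_three
    have := Real.add_one_le_exp 1
    nlinarith
  unfold zetaH
  set n := ⌈a⌉₊ - 1 with hn
  have hnc : (n : ℝ) + 1 = (⌈a⌉₊ : ℝ) := by
    have : 0 < ⌈a⌉₊ := Nat.ceil_pos.mpr ha
    have h : n + 1 = ⌈a⌉₊ := by omega
    exact_mod_cast h
  have hb : 0 < a - n := by
    have := Nat.ceil_lt_add_one ha.le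
    linarith
  have hs := aux_sum p (a - n) hp hb n (by linarith)
  rw [show (n : ℝ) + (a - n) = a by ring] at hs
  have hz := aux_hz p (a - n) hp
  rw [show 2 * π * (a - n) - π * p / 2 = 2 * π * a - π * p / 2 - n * (2 * π) by ring,
    Real.sin_sub_nat_mul_two_pi] at hz
  have hs0 : 0 ≤ ∑ r ∈ Finset.range n, ((r : ℝ) + (a - n)) ^ p :=
    Finset.sum_nonneg fun r _ => by positivity
  set S := ∑ r ∈ Finset.range n, ((r : ℝ) + (a - n)) ^ p
  have hS1 : S / Q p ≤ a ^ p / Q p := by gcongr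
  have hS0 : 0 ≤ S / Q p := by positivity
  rw [sub_div]
  rw [abs_le] at hz
  rw [abs_lt]
  constructor <;> linarith [hz.1, hz.2]
end

section
/- There exists a threshold P such that for every real p > P the set Z(p) of positive real zeroes of a ↦ ζ(-p, a) is finite and nonempty, and its largest element A(p) satisfies (p−1)/(2πe) − 1/2 < A(p) < p/(2πe) + (log p)/(4πe) + 1. -/
open Real HurwitzZeta

noncomputable def cosSer (σ φ x : ℝ) : ℝ := ∑' n : ℕ, Real.cos (2 * π * n * x - φ) / (n : ℝ) ^ σ

lemma cosTerm_bound (σ φ x : ℝ) (n : ℕ) :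
    ‖Real.cos (2 * π * n * x - φ) / (n : ℝ) ^ σ‖ ≤ 1 / (n : ℝ) ^ σ := by
  have h : (0:ℝ) ≤ (n : ℝ) ^ σ := by positivity
  rw [norm_div, Real.norm_of_nonneg h]
  exact div_le_div_of_nonneg_right (Real.abs_cos_le_one _) h

lemma cosTerm_summable {σ : ℝ} (hσ : 1 < σ) (φ x : ℝ) :
    Summable (fun n : ℕ => Real.cos (2 * π * n * x - φ) / (n : ℝ) ^ σ) :=
  Summable.of_norm_bounded (Real.summable_one_div_nat_rpow.mpr hσ) (cosTerm_bound σ φ x)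

lemma cosSer_deriv {σ : ℝ} (hσ : 2 < σ) (φ x : ℝ) :
    HasDerivAt (cosSer σ φ) (2 * π * cosSer (σ - 1) (φ - π / 2) x) x := by
  have key := hasDerivAt_tsum (𝕜 := ℝ) (u := fun n : ℕ => 2 * π * (1 / (n : ℝ) ^ (σ - 1)))
    (g := fun (n : ℕ) (x : ℝ) => Real.cos (2 * π * n * x - φ) / (n : ℝ) ^ σ)
    (g' := fun (n : ℕ) (x : ℝ) =>
      2 * π * (Real.cos (2 * π * n * x - (φ - π / 2)) / (n : ℝ) ^ (σ - 1))) (y₀ := 0)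
    ((Real.summable_one_div_nat_rpow.mpr (by linarith)).mul_left _) ?_ ?_
    (cosTerm_summable (by linarith) φ 0) x
  · rw [tsum_mul_left] at key
    exact key
  · intro n y
    have h1 : HasDerivAt (fun y : ℝ => 2 * π * n * y - φ) (2 * π * n) y := by
      simpa using ((hasDerivAt_id y).const_mul (2 * π * n)).sub_const φ
    have h2 := (h1.cos).div_const ((n : ℝ) ^ σ)
    convert! h2 using 1
    rcases Nat.eq_zero_or_pos n with rfl | hn
    · simp [Real.zero_rpow (by linarith : σ - 1 ≠ 0), Real.zero_rpow (by linarith : σ ≠ 0)]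
    · have hn' : (0:ℝ) < n := by exact_mod_cast hn
      rw [show 2 * π * n * y - (φ - π / 2) = (2 * π * n * y - φ) + π / 2 by ring,
        Real.cos_add_pi_div_two, Real.rpow_sub_one hn'.ne']
      have : (0:ℝ) < (n:ℝ) ^ σ := by positivity
      field_simp
  · intro n y
    rw [norm_mul, Real.norm_of_nonneg (by positivity : 0 ≤ 2 * π)]
    exact mul_le_mul_of_nonneg_left (cosTerm_bound _ _ _ _) (by positivity)

lemma cosSer_approx {σ : ℝ} (hσ : 12 ≤ σ) (φ x : ℝ) :
    |cosSer σ φ x - Real.cos (2 * π * x - φ)| ≤ 1 / 100 := by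
  have hs := cosTerm_summable (by linarith : 1 < σ) φ x
  have h1 : cosSer σ φ x - Real.cos (2 * π * x - φ) =
      ∑' n : ℕ, if n = 1 then 0 else Real.cos (2 * π * n * x - φ) / (n : ℝ) ^ σ := by
    rw [cosSer, hs.tsum_eq_add_tsum_ite 1]
    simp
  rw [h1]
  have hz := hasSum_zeta_two.mul_left ((1:ℝ) / 1024)
  have := tsum_of_norm_bounded hz
    (f := fun n : ℕ => if n = 1 then 0 else Real.cos (2 * π * n * x - φ) / (n : ℝ) ^ σ) ?_
  · rw [Real.norm_eq_abs] at this
    refine this.trans ?_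
    have : π < 3.15 := Real.pi_lt_d2
    have := Real.pi_pos
    nlinarith
  · intro n
    by_cases hn : n = 1
    · simp [hn]
    · rw [if_neg hn]
      refine (cosTerm_bound _ _ _ _).trans ?_
      rcases Nat.eq_zero_or_pos n with rfl | hn0
      · simp [Real.zero_rpow (by linarith : σ ≠ 0)]
      · have hn2 : (2:ℝ) ≤ n := by exact_mod_cast (by omega : 2 ≤ n)
        have h3 : (n:ℝ) ^ (12:ℝ) ≤ (n:ℝ) ^ σ := Real.rpow_le_rpow_of_exponent_le (by linarith) hσ
        have h4 : (n:ℝ) ^ (12:ℝ) = (n:ℝ) ^ 12 := by exact_mod_cast Real.rpow_natCast (n:ℝ) 12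
        have h5 : (2:ℝ) ^ 10 ≤ (n:ℝ) ^ 10 := pow_le_pow_left₀ (by norm_num) hn2 10
        rw [div_mul_div_comm, one_mul]
        apply div_le_div_of_nonneg_left (by norm_num) (by positivity)
        calc (1024:ℝ) * (n:ℝ)^2 ≤ (n:ℝ)^10 * (n:ℝ)^2 := by
              apply mul_le_mul_of_nonneg_right _ (by positivity); linarith
          _ = (n:ℝ)^12 := by ring
          _ ≤ _ := by rw [← h4]; exact h3

lemma hzeta_eq {p : ℝ} (hp : 0 < p) (x : ℝ) :
    hzeta (-p) x = Q p * cosSer (1 + p) (π * (1 + p) / 2) x := by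
  have hs1 : 1 < ((1 + p : ℝ) : ℂ).re := by simp [hp]
  have hf := hurwitzZeta_one_sub (x : UnitAddCircle) (s := ((1 + p : ℝ) : ℂ)) ?_ ?_
  · have e1 := (hasSum_expZeta_of_one_lt_re x hs1).mul_left
      (Complex.exp (-π * Complex.I * ((1 + p : ℝ) : ℂ) / 2))
    have e2 := (hasSum_expZeta_of_one_lt_re (-x) hs1).mul_left
      (Complex.exp (π * Complex.I * ((1 + p : ℝ) : ℂ) / 2))
    have e3 := e1.add e2
    have e4 : HasSum (fun n : ℕ => ((2 * (Real.cos (2 * π * n * x - π * (1 + p) / 2) /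
        (n : ℝ) ^ (1 + p)) : ℝ) : ℂ))
        ((2 * cosSer (1 + p) (π * (1 + p) / 2) x : ℝ) : ℂ) := by
      rw [Complex.hasSum_ofReal]
      exact (cosTerm_summable (by linarith) _ _).hasSum.mul_left 2
    have e5 := e3.unique (by
      convert! e4 using 2 with n
      rw [← mul_div_assoc, ← mul_div_assoc, ← Complex.exp_add, ← Complex.exp_add, ← add_div,
        ← mul_div_assoc]
      push_cast
      rw [Complex.ofReal_cpow (by positivity)]
      push_cast
      rw [Complex.two_cos]
      congr 3 <;> ring)
    have e6 : hurwitzZeta (x : UnitAddCircle) ((-p : ℝ) : ℂ) =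
        ((Q p * cosSer (1 + p) (π * (1 + p) / 2) x : ℝ) : ℂ) := by
      have : ((-p : ℝ) : ℂ) = 1 - ((1 + p : ℝ) : ℂ) := by push_cast; ring
      rw [this, hf, show -(x : UnitAddCircle) = ((-x : ℝ) : UnitAddCircle) by simp, e5,
        Complex.Gamma_ofReal, Q]
      have h2 : (2 * (π : ℂ)) ^ (-((1 + p : ℝ) : ℂ)) = (((2 * π) ^ (-(1 + p)) : ℝ) : ℂ) := by
        rw [Complex.ofReal_cpow (by positivity)]
        push_cast
        rfl
      rw [h2, Real.rpow_neg (by positivity)]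
      push_cast
      ring
    rw [hzeta, e6, Complex.ofReal_re]
  · intro n h
    have h' : (1 + p : ℝ) = -(n : ℝ) := by exact_mod_cast h
    have : (0:ℝ) ≤ n := by positivity
    linarith
  · right
    intro h
    have h' : (1 + p : ℝ) = 1 := by exact_mod_cast h
    linarith

noncomputable def pp (q x : ℝ) : ℝ := (max x 0) ^ q

lemma pp_nonneg (q x : ℝ) : 0 ≤ pp q x := by unfold pp; positivity

lemma pp_of_nonpos {q x : ℝ} (hq : 0 < q) (hx : x ≤ 0) : pp q x = 0 := by
  rw [pp, max_eq_right hx, Real.zero_rpow hq.ne']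

lemma pp_of_nonneg {q x : ℝ} (hx : 0 ≤ x) : pp q x = x ^ q := by
  rw [pp, max_eq_left hx]

lemma pp_mono {q x y : ℝ} (hq : 0 < q) (h : x ≤ y) : pp q x ≤ pp q y := by
  unfold pp
  exact Real.rpow_le_rpow (le_max_right _ _) (max_le_max_right 0 h) hq.le

lemma pp_deriv {q : ℝ} (hq : 1 < q) (x : ℝ) :
    HasDerivAt (pp q) (q * pp (q - 1) x) x := by
  rcases lt_trichotomy x 0 with h | h | h
  · rw [pp_of_nonpos (by linarith) h.le, mul_zero]
    refine (hasDerivAt_const x (0:ℝ)).congr_of_eventuallyEq ?_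
    filter_upwards [eventually_lt_nhds h] with y hy
    exact pp_of_nonpos (by linarith) hy.le
  · subst h
    rw [pp_of_nonpos (by linarith) le_rfl, mul_zero]
    have hl : HasDerivWithinAt (pp q) 0 (Set.Iic 0) 0 := by
      refine (hasDerivWithinAt_const (0:ℝ) _ (0:ℝ)).congr_of_mem ?_ (by simp)
      intro y hy
      exact pp_of_nonpos (by linarith) hy
    have hr : HasDerivWithinAt (pp q) 0 (Set.Ici 0) 0 := by
      have h1 := (Real.hasDerivAt_rpow_const (x := 0) (p := q) (Or.inr hq.le)).hasDerivWithinAt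
        (s := Set.Ici 0)
      rw [Real.zero_rpow (by linarith), mul_zero] at h1
      refine h1.congr_of_mem ?_ (by simp)
      intro y hy
      exact pp_of_nonneg hy
    have := hl.union hr
    rw [Set.Iic_union_Ici] at this
    exact hasDerivWithinAt_univ.mp this
  · rw [pp_of_nonneg h.le]
    refine (Real.hasDerivAt_rpow_const (Or.inl h.ne')).congr_of_eventuallyEq ?_
    filter_upwards [eventually_gt_nhds h] with y hy
    exact pp_of_nonneg hy.le

noncomputable def SS (N : ℕ) (q a : ℝ) : ℝ := ∑ k ∈ Finset.range N, pp q (a - (k + 1))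

lemma SS_deriv {q : ℝ} (hq : 1 < q) (N : ℕ) (x : ℝ) :
    HasDerivAt (SS N q) (q * SS N (q - 1) x) x := by
  unfold SS
  rw [Finset.mul_sum]
  refine HasDerivAt.fun_sum fun k _ => ?_
  exact (pp_deriv hq (x - (k + 1))).comp_sub_const x _

lemma SS_nonneg (N : ℕ) (q a : ℝ) : 0 ≤ SS N q a :=
  Finset.sum_nonneg fun _ _ => pp_nonneg _ _

noncomputable def GG (N : ℕ) (p a : ℝ) : ℝ :=
  Q p * cosSer (1 + p) (π * (1 + p) / 2) a - SS N p a

lemma zetaH_eq {p a : ℝ} (hp : 0 < p) (ha : 0 < a) {N : ℕ} (hN : a ≤ N) :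
    zetaH p a = GG N p a := by
  have hc : 0 < ⌈a⌉₊ := Nat.ceil_pos.mpr ha
  obtain ⟨m, hm⟩ : ∃ m, ⌈a⌉₊ = m + 1 := ⟨⌈a⌉₊ - 1, by omega⟩
  have hma : a ≤ m + 1 := by have := Nat.le_ceil a; rw [hm] at this; exact_mod_cast this
  have hmN : m ≤ N := by have := Nat.ceil_le.mpr hN; omega
  have hma' : (m : ℝ) < a := by
    have : m < ⌈a⌉₊ := by omega
    exact Nat.lt_ceil.mp this
  rw [zetaH, GG, hm, Nat.add_sub_cancel, ← hzeta_eq hp]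
  congr 1
  · unfold hzeta
    congr 2
    rw [QuotientAddGroup.mk_sub, sub_eq_self]
    have : ((m : ℝ) : UnitAddCircle) = (m : ℕ) • ((1 : ℝ) : UnitAddCircle) := by
      rw [← AddCircle.coe_nsmul]; simp
    change ((m : ℝ) : UnitAddCircle) = 0
    rw [this, AddCircle.coe_period, smul_zero]
  · rw [SS, ← Finset.sum_subset (Finset.range_mono hmN), ← Finset.sum_range_reflect]
    · refine Finset.sum_congr rfl fun k hk => ?_
      have hk' : k < m := Finset.mem_range.mp hk
      have h1 : ((m - 1 - k : ℕ) : ℝ) = m - 1 - k := by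
        rw [Nat.sub_sub, Nat.cast_sub (by omega)]; push_cast; ring
      have h2 : (k : ℝ) + 1 ≤ m := by exact_mod_cast hk'
      rw [pp_of_nonneg (by linarith), h1]
      congr 1
      ring
    · intro k _ hk
      have hk' : m ≤ k := by simpa using hk
      have h2 : (m : ℝ) ≤ k := by exact_mod_cast hk'
      exact pp_of_nonpos hp (by linarith)

lemma acc_step {f f' : ℝ → ℝ} (hf : ∀ x, HasDerivAt f (f' x) x) {c : ℝ}
    (h : ∃ᶠ y in nhdsWithin c {c}ᶜ, f y = 0) :
    f c = 0 ∧ f' c = 0 ∧ ∃ᶠ y in nhdsWithin c {c}ᶜ, f' y = 0 := by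
  have h0 : f c = 0 := by
    by_contra hne
    have := (hf c).continuousAt.eventually_ne hne
    exact h ((this.filter_mono nhdsWithin_le_nhds).mono fun y hy => hy)
  refine ⟨h0, ?_, ?_⟩
  · by_contra hne
    exact h (((hf c).eventually_ne hne (c := 0)).mono fun y hy => hy)
  · intro hev
    rw [Filter.Eventually, Metric.mem_nhdsWithin_iff] at hev
    obtain ⟨ε, hε, hball⟩ := hev
    apply h
    have hb : Metric.ball c ε ∈ nhdsWithin c {c}ᶜ :=
      mem_nhdsWithin_of_mem_nhds (Metric.ball_mem_nhds c hε)
    filter_upwards [hb, self_mem_nhdsWithin] with y hy hyc hfy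
    have hcont : Continuous f := continuous_iff_continuousAt.mpr fun x => (hf x).continuousAt
    rw [Real.ball_eq_Ioo] at hy hball
    rcases lt_or_gt_of_ne hyc with hlt | hlt
    · obtain ⟨z, hz, hz'⟩ := exists_hasDerivAt_eq_zero hlt hcont.continuousOn (by rw [hfy, h0])
        (fun x _ => hf x)
      exact hball ⟨⟨by linarith [hy.1, hz.1], by linarith [hz.2]⟩, hz.2.ne⟩ hz'
    · obtain ⟨z, hz, hz'⟩ := exists_hasDerivAt_eq_zero hlt hcont.continuousOn (by rw [hfy, h0])
        (fun x _ => hf x)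
      exact hball ⟨⟨by linarith [hz.1], by linarith [hy.2, hz.2]⟩, hz.1.ne'⟩ hz'

lemma Q_pos {p : ℝ} (hp : 0 < p) : 0 < Q p := by
  unfold Q
  have := Real.Gamma_pos_of_pos (by linarith : 0 < 1 + p)
  positivity

lemma GG_finite {p B : ℝ} (hp : 13 ≤ p) (hB : B ≤ p - 1) (N : ℕ) :
    {a : ℝ | 0 < a ∧ a ≤ B ∧ GG N p a = 0}.Finite := by
  by_contra hinf
  have hinf : {a : ℝ | 0 < a ∧ a ≤ B ∧ GG N p a = 0}.Infinite := hinf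
  obtain ⟨c, hc, hacc⟩ := hinf.exists_accPt_of_subset_isCompact (isCompact_Icc (a := 0) (b := B))
    (fun a ha => ⟨ha.1.le, ha.2.1⟩)
  rw [accPt_iff_frequently_nhdsNE] at hacc
  set φ := π * (1 + p) / 2 with hφ
  have d1 : ∀ x, HasDerivAt (GG N p)
      (Q p * (2 * π * cosSer p (φ - π / 2) x) - p * SS N (p - 1) x) x := by
    intro x
    have := cosSer_deriv (by linarith : 2 < 1 + p) φ x
    rw [show 1 + p - 1 = p by ring] at this
    exact (this.const_mul _).sub (SS_deriv (by linarith) N x)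
  have d2 : ∀ x, HasDerivAt (fun x => Q p * (2 * π * cosSer p (φ - π / 2) x) - p * SS N (p - 1) x)
      (Q p * (2 * π * (2 * π * cosSer (p - 1) (φ - π / 2 - π / 2) x))
        - p * ((p - 1) * SS N (p - 1 - 1) x)) x := by
    intro x
    exact (((cosSer_deriv (by linarith : 2 < p) (φ - π / 2) x).const_mul _).const_mul _).sub
      ((SS_deriv (by linarith) N x).const_mul _)
  obtain ⟨h0, h1, hfr⟩ := acc_step d1 (hacc.mono fun y hy => hy.2.2)
  obtain ⟨-, h2, -⟩ := acc_step d2 hfr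
  have a0 := abs_le.mp (cosSer_approx (by linarith : 12 ≤ 1 + p) φ c)
  have a1 := abs_le.mp (cosSer_approx (by linarith : 12 ≤ p) (φ - π / 2) c)
  have a2 := abs_le.mp (cosSer_approx (by linarith : 12 ≤ p - 1) (φ - π / 2 - π / 2) c)
  rw [show 2 * π * c - (φ - π / 2) = (2 * π * c - φ) + π / 2 by ring,
    Real.cos_add_pi_div_two] at a1
  rw [show 2 * π * c - (φ - π / 2 - π / 2) = (2 * π * c - φ) + π by ring, Real.cos_add_pi] at a2
  have hsc := Real.sin_sq_add_cos_sq (2 * π * c - φ)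
  rw [GG, ← hφ] at h0
  have hQ := Q_pos (by linarith : 0 < p)
  have hS0 := SS_nonneg N p c
  have hS1 := SS_nonneg N (p - 1) c
  have hS2 := SS_nonneg N (p - 1 - 1) c
  have hS12 : SS N (p - 1) c ≤ (p - 1) * SS N (p - 1 - 1) c := by
    unfold SS
    rw [Finset.mul_sum]
    refine Finset.sum_le_sum fun k _ => ?_
    have hk : (0:ℝ) ≤ k := by positivity
    rcases le_or_gt (c - (k + 1)) 0 with h | h
    · rw [pp_of_nonpos (by linarith) h, pp_of_nonpos (by linarith) h]; simp
    · rw [pp_of_nonneg h.le, pp_of_nonneg h.le]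
      have : (c - (k + 1)) ^ (p - 1) = (c - (k + 1)) * (c - (k + 1)) ^ (p - 1 - 1) := by
        rw [Real.rpow_sub_one h.ne' (p - 1)]; field_simp
      rw [this]
      exact mul_le_mul_of_nonneg_right (by linarith [hc.2]) (by positivity)
  set X := cosSer (1 + p) φ c
  set Y := cosSer p (φ - π / 2) c
  set W := cosSer (p - 1) (φ - π / 2 - π / 2) c
  set s := Real.sin (2 * π * c - φ)
  set t := Real.cos (2 * π * c - φ)
  have hpi := Real.pi_pos
  have hpi3 := Real.pi_gt_three
  have hpi4 : π < 3.15 := Real.pi_lt_d2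
  have hX : 0 ≤ X := by
    by_contra hneg
    have := mul_neg_of_pos_of_neg hQ (not_le.mp hneg)
    linarith
  have hYQ : Q p * (2 * π * Y) = p * SS N (p - 1) c := by linarith
  have hWQ : Q p * (2 * π * (2 * π * W)) = p * ((p - 1) * SS N (p - 1 - 1) c) := by linarith
  have hY : 0 ≤ Y := by
    by_contra hneg
    have h3 : 2 * π * Y < 0 := mul_neg_of_pos_of_neg (by positivity) (not_le.mp hneg)
    have := mul_neg_of_pos_of_neg hQ h3
    have : 0 ≤ p * SS N (p - 1) c := mul_nonneg (by linarith) hS1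
    linarith
  have hYW : Y ≤ 2 * π * W := by
    have h3 : p * SS N (p - 1) c ≤ p * ((p - 1) * SS N (p - 1 - 1) c) :=
      mul_le_mul_of_nonneg_left hS12 (by linarith)
    rw [← hYQ, ← hWQ] at h3
    have h4 := le_of_mul_le_mul_left h3 hQ
    exact le_of_mul_le_mul_left h4 (by positivity)
  have hW : 0 ≤ W := by
    by_contra hneg
    have : 2 * π * W < 0 := mul_neg_of_pos_of_neg (by positivity) (not_le.mp hneg)
    linarith
  have hWs : W ≤ 1 / 50 := by linarith [a0.1, a0.2, a2.1, a2.2]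
  have hXs : X ≤ 1 / 50 := by linarith [a0.1, a0.2, a2.1, a2.2]
  have hYs : Y ≤ 1 / 5 := by nlinarith
  have ht1 : t ≤ 1 / 4 := by linarith [a0.1]
  have ht2 : -(1 / 4) ≤ t := by linarith [a0.2]
  have hs1 : s ≤ 1 / 4 := by linarith [a1.1, a1.2]
  have hs2 : -(1 / 4) ≤ s := by linarith [a1.1, a1.2]
  nlinarith

lemma Gamma_lower {p : ℝ} (hp : 0 < p) : p ^ p * Real.exp (-p) ≤ Real.Gamma (1 + p) := by
  have hint := Real.GammaIntegral_convergent (by linarith : 0 < 1 + p)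
  rw [Real.Gamma_eq_integral (by linarith)]
  have hsub : Set.Ioi p ⊆ Set.Ioi (0:ℝ) := Set.Ioi_subset_Ioi hp.le
  calc p ^ p * Real.exp (-p) = ∫ x in Set.Ioi p, p ^ p * Real.exp (-x) := by
        rw [MeasureTheory.integral_const_mul, integral_exp_neg_Ioi]
    _ ≤ ∫ x in Set.Ioi p, Real.exp (-x) * x ^ (1 + p - 1) := by
        apply MeasureTheory.setIntegral_mono_on _ (hint.mono_set hsub) measurableSet_Ioi
        · intro x hx
          rw [mul_comm, add_sub_cancel_left]
          exact mul_le_mul_of_nonneg_left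
            (Real.rpow_le_rpow hp.le (le_of_lt hx) hp.le) (Real.exp_pos _).le
        · exact (integrableOn_exp_neg_Ioi p).const_mul _
    _ ≤ _ := by
        apply MeasureTheory.setIntegral_mono_set hint _ hsub.eventuallyLE
        rw [Filter.EventuallyLE, MeasureTheory.ae_restrict_iff' measurableSet_Ioi]
        refine Filter.Eventually.of_forall fun x hx => ?_
        have : (0:ℝ) < x := hx
        simp only [Pi.zero_apply]
        positivity

lemma log_factorial_upper {n : ℕ} (hn : 0 < n) :
    Real.log (n.factorial : ℝ) ≤ 1 + Real.log n / 2 + n * Real.log n - n := by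
  obtain ⟨m, rfl⟩ : ∃ m, n = m + 1 := ⟨n - 1, by omega⟩
  have h1 := Stirling.log_stirlingSeq'_antitone (Nat.zero_le m)
  simp only [Function.comp, Nat.succ_eq_add_one, zero_add] at h1
  rw [Stirling.log_stirlingSeq_formula, Stirling.stirlingSeq_one,
    Real.log_div (Real.exp_pos 1).ne' (by positivity), Real.log_exp, Real.log_sqrt (by norm_num),
    Real.log_mul (by norm_num) (by positivity),
    Real.log_div (by positivity) (Real.exp_pos 1).ne', Real.log_exp] at h1
  linarith

lemma log_three : 1.08 ≤ Real.log 3 := by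
  rw [Real.le_log_iff_exp_le (by norm_num)]
  have h1 := Real.exp_one_lt_d9
  have h2 : Real.exp 0.08 ≤ 1 / (1 - 0.08) := by
    have h3 := Real.add_one_le_exp (-0.08 : ℝ)
    rw [Real.exp_neg] at h3
    have h4 := Real.exp_pos 0.08
    rw [le_div_iff₀ (by norm_num)]
    rw [inv_eq_one_div, le_div_iff₀ h4] at h3
    linarith
  rw [show (1.08 : ℝ) = 1 + 0.08 by norm_num, Real.exp_add]
  have := Real.exp_pos 0.08
  have := Real.exp_pos 1
  calc Real.exp 1 * Real.exp 0.08 ≤ 2.7182818286 * (1 / (1 - 0.08)) := by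
        apply mul_le_mul h1.le h2 <;> norm_num <;> linarith
    _ ≤ 3 := by norm_num

lemma log_Gamma_upper {p : ℝ} (hp : 200 ≤ p) :
    Real.log (Real.Gamma (1 + p)) ≤ 1.02 + Real.log p / 2 + p * Real.log p - p := by
  obtain ⟨n, hn⟩ : ∃ n, ⌈p⌉₊ = n + 1 :=
    ⟨⌈p⌉₊ - 1, by have := Nat.ceil_pos.mpr (by linarith : 0 < p); omega⟩
  have hpn : p ≤ n + 1 := by have := Nat.le_ceil p; rw [hn] at this; exact_mod_cast this
  have hnp : (n : ℝ) < p := Nat.lt_ceil.mp (by omega)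
  have hn0 : (0:ℝ) < n := by linarith
  have hn0' : 0 < n := by exact_mod_cast hn0
  have hp0 : 0 < p := by linarith
  have h1 := Real.BohrMollerup.f_add_nat_le (n := n + 1) (x := p - n) Real.convexOn_log_Gamma
    (fun {y} hy => by
      rw [Function.comp_apply, Real.Gamma_add_one hy.ne', Real.log_mul hy.ne'
        (Real.Gamma_pos_of_pos hy).ne', add_comm, Function.comp_apply])
    (by omega) (by linarith) (by linarith)
  simp only [Function.comp_apply] at h1
  rw [show (((n + 1 : ℕ) : ℝ) + (p - n)) = 1 + p by push_cast; ring] at h1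
  push_cast at h1
  rw [Real.Gamma_nat_eq_factorial] at h1
  have h2 := log_factorial_upper hn0'
  have h3 : 1 - n / p ≤ Real.log p - Real.log n := by
    have := Real.one_sub_inv_le_log_of_pos (div_pos hp0 hn0)
    rwa [Real.log_div hp0.ne' hn0.ne', inv_div] at this
  have h4 : 1 - (n + 1) / p ≤ Real.log p - Real.log (n + 1) := by
    have := Real.one_sub_inv_le_log_of_pos (div_pos hp0 (by linarith : (0:ℝ) < n + 1))
    rwa [Real.log_div hp0.ne' (by linarith), inv_div] at this
  have h5 : 0 ≤ Real.log p - Real.log n := by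
    have := Real.log_le_log hn0 hnp.le
    linarith
  set t := p - n with ht
  have ht0 : 0 ≤ t := by linarith
  have ht1 : t ≤ 1 := by linarith
  have hnt : (n : ℝ) = p - t := by linarith
  have hinv : 1 / p ≤ 0.005 := by rw [div_le_iff₀ hp0]; linarith
  have hinv0 : 0 < 1 / p := by positivity
  have h6 : 1 - n / p = t * (1 / p) := by rw [hnt]; field_simp; ring
  have h7 : 1 - (n + 1) / p = (t - 1) * (1 / p) := by rw [hnt]; field_simp; ring
  rw [h6] at h3
  rw [h7] at h4
  have h8 : n * (t * (1 / p)) ≤ n * (Real.log p - Real.log n) :=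
    mul_le_mul_of_nonneg_left h3 hn0.le
  have h9 : t * ((t - 1) * (1 / p)) ≤ t * (Real.log p - Real.log (n + 1)) :=
    mul_le_mul_of_nonneg_left h4 ht0
  have h10 : n * (t * (1 / p)) = t - t * t * (1 / p) := by rw [hnt]; field_simp
  have h11 : t * t * (1 / p) ≤ 1 * 0.005 :=
    mul_le_mul (by nlinarith) hinv hinv0.le (by norm_num)
  have h12 : -(0.005) ≤ t * ((t - 1) * (1 / p)) := by
    have : t * (1 - t) * (1 / p) ≤ 1 * 0.005 :=
      mul_le_mul (by nlinarith) hinv hinv0.le (by norm_num)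
    nlinarith
  have h13 : p * Real.log p = n * Real.log p + t * Real.log p := by rw [ht]; ring
  rw [h13]
  nlinarith

lemma upper_key {p a : ℝ} (hp : 200 ≤ p) (hlog : Real.log p ^ 2 ≤ 0.1 * p) (ha : 0 < a)
    (h : 0 ≤ zetaH p a) :
    a < p / (2 * π * Real.exp 1) + Real.log p / (4 * π * Real.exp 1) + 1 := by
  have hE := Real.exp_pos 1
  have hpi := Real.pi_pos
  have hp0 : 0 < p := by linarith
  have hlp : 0 ≤ Real.log p := Real.log_nonneg (by linarith)
  by_contra hcon
  have hcon := not_lt.mp hcon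
  set L := Real.log p / 2 with hL
  set D := p / (2 * π * Real.exp 1) with hD
  have hD0 : 0 < D := by positivity
  have hbd : D * (1 + L / p) ≤ a - 1 := by
    have : D * (1 + L / p) = D + Real.log p / (4 * π * Real.exp 1) := by
      rw [hD, hL]; field_simp; ring
    linarith
  have hL0 : 0 ≤ L := by positivity
  have h1p : 0 < 1 + L / p := by positivity
  have ha1 : 0 < a - 1 := lt_of_lt_of_le (by positivity) hbd
  rw [zetaH_eq hp0 ha (Nat.le_ceil a), GG] at h
  have hS : (a - 1) ^ p ≤ SS ⌈a⌉₊ p a := by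
    have := Finset.single_le_sum (f := fun k : ℕ => pp p (a - (k + 1)))
      (fun k _ => pp_nonneg _ _) (Finset.mem_range.mpr (Nat.ceil_pos.mpr ha))
    simp only [Nat.cast_zero, zero_add] at this
    rw [pp_of_nonneg ha1.le] at this
    exact this
  have hQ := Q_pos hp0
  have hc : cosSer (1 + p) (π * (1 + p) / 2) a ≤ 1.01 := by
    have h1 := (abs_le.mp (cosSer_approx (by linarith : 12 ≤ 1 + p) (π * (1 + p) / 2) a)).2
    have h2 := Real.cos_le_one (2 * π * a - π * (1 + p) / 2)
    linarith
  have h3 : (a - 1) ^ p ≤ Q p * 1.01 := by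
    have := mul_le_mul_of_nonneg_left hc hQ.le
    linarith
  have h4 := Real.log_le_log (by positivity) h3
  have hG := Real.Gamma_pos_of_pos (by linarith : 0 < 1 + p)
  rw [Real.log_rpow ha1, Real.log_mul hQ.ne' (by norm_num), Q,
    Real.log_div (by positivity) (by positivity), Real.log_mul (by norm_num) hG.ne',
    Real.log_rpow (by positivity), Real.log_mul (by norm_num) hpi.ne'] at h4
  have h5 := log_Gamma_upper hp
  have h6 : Real.log 1.01 ≤ 0.01 := by
    have := Real.log_le_sub_one_of_pos (by norm_num : (0:ℝ) < 1.01)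
    linarith
  have h7 : 1.08 ≤ Real.log π :=
    log_three.trans (Real.log_le_log (by norm_num) Real.pi_gt_three.le)
  have h8 := Real.log_le_log (by positivity) hbd
  rw [Real.log_mul hD0.ne' h1p.ne', hD, Real.log_div hp0.ne' (by positivity),
    Real.log_mul (by positivity) hE.ne', Real.log_mul (by norm_num) hpi.ne', Real.log_exp] at h8
  have h9 : L / (p + L) ≤ Real.log (1 + L / p) := by
    have := Real.one_sub_inv_le_log_of_pos h1p
    have h10 : 1 - (1 + L / p)⁻¹ = L / (p + L) := by field_simp; ring
    rwa [h10] at this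
  have h10 : p * (L / (p + L)) ≤ L - 0.05 := by
    have h11 := mul_le_mul_of_nonneg_left (h8) hp0.le
    have h12 := mul_le_mul_of_nonneg_left (h9) hp0.le
    nlinarith
  rw [mul_div_assoc', div_le_iff₀ (by positivity)] at h10
  have : L ^ 2 ≤ 0.025 * p := by rw [hL]; nlinarith
  nlinarith

lemma lower_key {p a : ℝ} (hp : 200 ≤ p) (N : ℕ)
    (ha : a ≤ (p - 1) / (2 * π * Real.exp 1) - 1 / 2 + 1)
    (hcos : Real.cos (2 * π * a - π * (1 + p) / 2) = 1) : 0 ≤ GG N p a := by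
  have hE := Real.exp_pos 1
  have hE2 : 2.7 < Real.exp 1 := by have := Real.exp_one_gt_d9; linarith
  have hpi := Real.pi_pos
  have hpi3 := Real.pi_gt_three
  have hpi4 : π < 3.15 := Real.pi_lt_d2
  have hp0 : 0 < p := by linarith
  set D := p / (2 * π * Real.exp 1) with hD
  have hD0 : 0 < D := by positivity
  have hQ : D ^ p / π ≤ Q p := by
    have h1 := Gamma_lower hp0
    have h2 : D ^ p = p ^ p * Real.exp (-p) / (2 * π) ^ p := by
      rw [hD, Real.div_rpow hp0.le (by positivity), Real.mul_rpow (by positivity) hE.le,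
        ← Real.exp_mul, one_mul, Real.exp_neg]
      field_simp
    rw [h2, Q, Real.rpow_add (by positivity), Real.rpow_one]
    have h3 : 0 < (2 * π) ^ p := by positivity
    rw [div_div, div_le_div_iff₀ (by positivity) (by positivity)]
    have := mul_le_mul_of_nonneg_right h1 (by positivity : 0 ≤ (2 * π) ^ p * π)
    nlinarith
  have hk : ∀ k : ℕ, pp p (a - (k + 1)) ≤ D ^ p * (1 / 8 * (1 / 2) ^ k) := by
    intro k
    have hk0 : (0:ℝ) ≤ k := by positivity
    rcases le_or_gt (a - (k + 1)) 0 with h | h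
    · rw [pp_of_nonpos hp0 h]; positivity
    · rw [pp_of_nonneg h.le]
      set u := 1 + π * Real.exp 1 + 2 * π * Real.exp 1 * k with hu
      have h1 : a - (k + 1) ≤ D * Real.exp (-(u / p)) := by
        have h2 := Real.add_one_le_exp (-(u / p))
        have h3 := mul_le_mul_of_nonneg_left h2 hD0.le
        have h4 : D * (-(u / p) + 1) = (p - 1) / (2 * π * Real.exp 1) - 1 / 2 - k := by
          rw [hD, hu]; field_simp; ring
        linarith
      have h5 := Real.rpow_le_rpow h.le h1 hp0.le
      rw [Real.mul_rpow hD0.le (Real.exp_pos _).le, ← Real.exp_mul,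
        show -(u / p) * p = -u by field_simp] at h5
      refine h5.trans (mul_le_mul_of_nonneg_left ?_ (by positivity))
      have hpe : 8 ≤ π * Real.exp 1 := by nlinarith
      have h6 : -u ≤ -3 + k * (-1) := by rw [hu]; nlinarith
      have h7 : Real.exp (-1) ≤ 1 / 2 := by
        rw [Real.exp_neg, inv_eq_one_div]
        exact one_div_le_one_div_of_le (by norm_num) (by linarith)
      have h8 : Real.exp (-3) ≤ 1 / 8 := by
        have : Real.exp (-3) = Real.exp (-1) ^ 3 := by rw [← Real.exp_nat_mul]; norm_num
        rw [this]
        calc _ ≤ (1 / 2 : ℝ) ^ 3 := pow_le_pow_left₀ (Real.exp_pos _).le h7 3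
          _ = _ := by norm_num
      calc Real.exp (-u) ≤ Real.exp (-3 + k * (-1)) := Real.exp_le_exp.mpr h6
        _ = Real.exp (-3) * Real.exp (-1) ^ k := by rw [Real.exp_add, Real.exp_nat_mul]
        _ ≤ _ := mul_le_mul h8 (pow_le_pow_left₀ (Real.exp_pos _).le h7 k) (by positivity)
              (by norm_num)
  have hS : SS N p a ≤ D ^ p * (1 / 4) := by
    refine (Finset.sum_le_sum fun k _ => hk k).trans ?_
    rw [← Finset.mul_sum, ← Finset.mul_sum]
    have := sum_geometric_two_le N
    have h0 : 0 ≤ D ^ p := by positivity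
    exact mul_le_mul_of_nonneg_left (by linarith) h0
  have hc := (abs_le.mp (cosSer_approx (by linarith : 12 ≤ 1 + p) (π * (1 + p) / 2) a)).1
  rw [hcos] at hc
  have hc' : 0.99 ≤ cosSer (1 + p) (π * (1 + p) / 2) a := by linarith
  have hQ0 := Q_pos hp0
  have h1 := mul_le_mul_of_nonneg_left hc' hQ0.le
  have hDp : 0 < D ^ p := by positivity
  rw [div_le_iff₀ hpi] at hQ
  rw [GG]
  nlinarith

lemma GG_continuous {p : ℝ} (hp : 13 ≤ p) (N : ℕ) : Continuous (GG N p) :=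
  continuous_iff_continuousAt.mpr fun x =>
    (((cosSer_deriv (by linarith : 2 < 1 + p) (π * (1 + p) / 2) x).const_mul (Q p)).sub
      (SS_deriv (by linarith) N x)).continuousAt

theorem stmt_3 :
    ∃ P : ℝ, ∀ p : ℝ, P < p →
      {a : ℝ | 0 < a ∧ zetaH p a = 0}.Finite ∧
      ∃ A : ℝ, (0 < A ∧ zetaH p A = 0) ∧
        (∀ x : ℝ, 0 < x → zetaH p x = 0 → x ≤ A) ∧
        (p - 1) / (2 * π * Real.exp 1) - 1 / 2 < A ∧
        A < p / (2 * π * Real.exp 1) + Real.log p / (4 * π * Real.exp 1) + 1 := by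
  have hev : ∀ᶠ p : ℝ in Filter.atTop, Real.log p ^ 2 ≤ 0.1 * p := by
    have h1 := (Real.isLittleO_pow_log_id_atTop (n := 2)).bound (by norm_num : (0:ℝ) < 0.1)
    filter_upwards [h1, Filter.eventually_ge_atTop 0] with p hp hp0
    rw [Real.norm_of_nonneg (by positivity), id, Real.norm_of_nonneg hp0] at hp
    exact hp
  obtain ⟨P, hP⟩ := Filter.eventually_atTop.mp hev
  refine ⟨max P 200, fun p hp => ?_⟩
  have hlog := hP p ((le_max_left _ _).trans hp.le)
  have hp200 : 200 ≤ p := (le_max_right _ _).trans hp.le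
  clear hP hp hev
  have hp0 : 0 < p := by linarith
  have hE := Real.exp_pos 1
  have hE2 : 2.7 < Real.exp 1 := by have := Real.exp_one_gt_d9; linarith
  have hE3 : Real.exp 1 < 3 := by have := Real.exp_one_lt_d9; linarith
  have hpi := Real.pi_pos
  have hpi3 := Real.pi_gt_three
  have hpi4 : π < 3.15 := Real.pi_lt_d2
  have hup := fun a => upper_key (a := a) hp200 hlog
  have hlo := fun a => lower_key (a := a) hp200
  have hlp : 0 ≤ Real.log p := Real.log_nonneg (by linarith)
  have hpe : 8 ≤ π * Real.exp 1 := by nlinarith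
  have hpe' : π * Real.exp 1 ≤ 10 := by nlinarith
  set X := (p - 1) / (2 * π * Real.exp 1) - 1 / 2 with hX
  set B := p / (2 * π * Real.exp 1) + Real.log p / (4 * π * Real.exp 1) + 1 with hB
  have hX0 : 0 < X := by
    have : 1 ≤ (p - 1) / (2 * π * Real.exp 1) := by
      rw [le_div_iff₀ (by positivity)]; nlinarith
    linarith
  have hBp : B ≤ p - 1 := by
    have h1 : p / (2 * π * Real.exp 1) ≤ p / 16 :=
      div_le_div_of_nonneg_left hp0.le (by norm_num) (by nlinarith)
    have h2 : Real.log p / (4 * π * Real.exp 1) ≤ Real.log p / 32 :=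
      div_le_div_of_nonneg_left hlp (by norm_num) (by nlinarith)
    have h3 := Real.log_le_sub_one_of_pos hp0
    linarith
  have hB0 : 0 < B := by positivity
  have hfin : {a : ℝ | 0 < a ∧ zetaH p a = 0}.Finite := by
    refine (GG_finite (by linarith : 13 ≤ p) hBp ⌈B⌉₊).subset ?_
    rintro a ⟨ha, hz⟩
    have haB := (hup a ha hz.ge).le
    refine ⟨ha, haB, ?_⟩
    rw [← zetaH_eq hp0 ha (haB.trans (Nat.le_ceil B)), hz]
  refine ⟨hfin, ?_⟩
  obtain ⟨z, hz0, hzX, hz⟩ : ∃ z, 0 < z ∧ X < z ∧ zetaH p z = 0 := by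
    set m : ℤ := ⌊X - (1 + p) / 4⌋ + 1 with hm
    set a0 : ℝ := (1 + p) / 4 + m with ha0
    have h1 : X < a0 := by
      have := Int.lt_floor_add_one (X - (1 + p) / 4)
      rw [ha0, hm]; push_cast; linarith
    have h2 : a0 ≤ X + 1 := by
      have := Int.floor_le (X - (1 + p) / 4)
      rw [ha0, hm]; push_cast; linarith
    have h3 : Real.cos (2 * π * a0 - π * (1 + p) / 2) = 1 := by
      rw [show 2 * π * a0 - π * (1 + p) / 2 = m * (2 * π) by rw [ha0]; ring]
      exact Real.cos_int_mul_two_pi m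
    set a1 := max B a0
    set N := ⌈a1⌉₊
    have h4 : 0 ≤ GG N p a0 := hlo a0 N h2 h3
    have ha1 : 0 < a1 := lt_of_lt_of_le hB0 (le_max_left _ _)
    have h5 : GG N p a1 ≤ 0 := by
      by_contra hc
      rw [← zetaH_eq hp0 ha1 (Nat.le_ceil a1)] at hc
      have := hup a1 ha1 (not_le.mp hc).le
      have : B ≤ a1 := le_max_left _ _
      linarith
    obtain ⟨z, hz, hzz⟩ := intermediate_value_Icc' (le_max_right B a0)
      (GG_continuous (by linarith) N).continuousOn ⟨h5, h4⟩
    have hz0 : 0 < z := by linarith [hz.1]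
    refine ⟨z, hz0, by linarith [hz.1], ?_⟩
    rw [zetaH_eq hp0 hz0 (hz.2.trans (Nat.le_ceil a1))]
    exact hzz
  obtain ⟨A, hA, hAmax⟩ := Set.exists_max_image _ id hfin ⟨z, hz0, hz⟩
  exact ⟨A, hA, fun x hx hx' => hAmax x ⟨hx, hx'⟩, lt_of_lt_of_le hzX (hAmax z ⟨hz0, hz⟩),
    hup A hA.1 hA.2.ge⟩
end

section
/- For every ε > 0 there exists a threshold P such that for every real p > P, every zero a ∈ (0, (p−1)/(2πe)) of the function a ↦ ζ(-p, a) is simple (the derivative of a ↦ ζ(-p, a) at a is nonzero) and lies within ε of the half-integer lattice shifted by p/4: there exists an integer l with |a − (p/4 + l/2)| < ε. -/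
open Real HurwitzZeta

namespace Stmt5

/-- The `k`-th term of the Fourier series. -/
noncomputable def ft (p : ℝ) (k : ℕ) (x : ℝ) : ℝ :=
  Real.sin (2 * π * k * x - π * p / 2) / (k : ℝ) ^ (1 + p)

/-- Derivative of the `k`-th term of the Fourier series. -/
noncomputable def ft' (p : ℝ) (k : ℕ) (x : ℝ) : ℝ :=
  Real.cos (2 * π * k * x - π * p / 2) * (2 * π * k) / (k : ℝ) ^ (1 + p)

lemma hasSum_hzeta (p : ℝ) (hp : 0 < p) (x : ℝ) :
    HasSum (fun k : ℕ => Q p * ft p k x) (hzeta (-p) x) := by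
  have hs1 : 1 < ((1 + p : ℝ) : ℂ).re := by simp [hp]
  have h1 := hasSum_expZeta_of_one_lt_re x hs1
  have h2 := hasSum_expZeta_of_one_lt_re (-x) hs1
  have hfe := hurwitzZeta_one_sub (x : UnitAddCircle) (s := ((1 + p : ℝ) : ℂ))
    (by
      intro n h
      have := congrArg Complex.re h
      simp at this
      have hn : (0 : ℝ) ≤ n := n.cast_nonneg
      linarith)
    (Or.inr (by
      intro h
      have := congrArg Complex.re h
      simp at this
      linarith))
  have h3 := ((h1.mul_left (Complex.exp (-π * Complex.I * ((1 + p : ℝ) : ℂ) / 2))).add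
    (h2.mul_left (Complex.exp (π * Complex.I * ((1 + p : ℝ) : ℂ) / 2)))).mul_left
      ((2 * π : ℂ) ^ (-((1 + p : ℝ) : ℂ)) * Complex.Gamma ((1 + p : ℝ) : ℂ))
  have hneg : ((-x : ℝ) : UnitAddCircle) = -(x : UnitAddCircle) := by push_cast; rfl
  rw [hneg, ← hfe] at h3
  have h4 : (1 : ℂ) - ((1 + p : ℝ) : ℂ) = ((-p : ℝ) : ℂ) := by push_cast; ring
  rw [h4] at h3
  have h5 := Complex.hasSum_re h3
  unfold hzeta
  convert h5 using 1
  ext k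
  rw [← Complex.ofReal_re (Q p * ft p k x)]
  congr 1
  have hpow : (2 * π : ℂ) ^ (-((1 + p : ℝ) : ℂ)) = (((2 * π) ^ (1 + p) : ℝ) : ℂ)⁻¹ := by
    rw [Complex.cpow_neg, Complex.ofReal_cpow (by positivity)]
    push_cast; rfl
  have hk : (k : ℂ) ^ ((1 + p : ℝ) : ℂ) = (((k : ℝ) ^ (1 + p) : ℝ) : ℂ) := by
    rw [Complex.ofReal_cpow (by positivity)]
    push_cast; rfl
  rw [hpow, hk, Complex.Gamma_ofReal]
  have hsin : Real.sin (2 * π * k * x - π * p / 2)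
      = Real.cos (2 * π * k * x - π * (1 + p) / 2) := by
    rw [← Real.cos_sub_pi_div_two]; congr 1; ring
  have hcos : Complex.exp (-π * Complex.I * ((1 + p : ℝ) : ℂ) / 2)
        * Complex.exp (2 * π * Complex.I * x * k)
      + Complex.exp (π * Complex.I * ((1 + p : ℝ) : ℂ) / 2)
        * Complex.exp (2 * π * Complex.I * ((-x : ℝ) : ℂ) * k)
      = 2 * ((Real.sin (2 * π * k * x - π * p / 2) : ℝ) : ℂ) := by
    rw [hsin, Complex.ofReal_cos, Complex.cos, ← Complex.exp_add, ← Complex.exp_add]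
    push_cast
    rw [mul_div_cancel₀ _ (two_ne_zero)]
    congr 2 <;> ring
  unfold Q ft
  rw [← mul_div_assoc (Complex.exp _), ← mul_div_assoc (Complex.exp _), ← add_div, hcos]
  push_cast
  ring

lemma ft_hasDerivAt (p : ℝ) (k : ℕ) (x : ℝ) : HasDerivAt (ft p k) (ft' p k x) x := by
  unfold ft ft'
  have h : HasDerivAt (fun x : ℝ => 2 * π * k * x - π * p / 2) (2 * π * k) x := by
    simpa using ((hasDerivAt_id x).const_mul (2 * π * k)).sub_const (π * p / 2)
  exact h.sin.div_const _

lemma pow_bound (p : ℝ) (hp : 2 ≤ p) (k : ℕ) :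
    ((k + 2 : ℕ) : ℝ) / ((k + 2 : ℕ) : ℝ) ^ (1 + p) ≤
      2 ^ (2 - p) * (1 / ((k + 2 : ℕ) : ℝ) ^ 2) := by
  have hk : (2 : ℝ) ≤ ((k + 2 : ℕ) : ℝ) := by push_cast; linarith [k.cast_nonneg (α := ℝ)]
  set y : ℝ := ((k + 2 : ℕ) : ℝ)
  have hy : 0 < y := by linarith
  have e : y / y ^ (1 + p) = y ^ (2 - p) * (1 / y ^ 2) := by
    rw [Real.rpow_add hy, Real.rpow_sub hy]
    have := Real.rpow_pos_of_pos hy p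
    simp
    field_simp
  rw [e]
  gcongr ?_ * _
  exact Real.rpow_le_rpow_of_nonpos (by norm_num) hk (by linarith)

/-- The constant bounding the tail. -/
noncomputable def C : ℝ := ∑' k : ℕ, 1 / ((k + 2 : ℕ) : ℝ) ^ 2

lemma summC : Summable (fun k : ℕ => 1 / ((k + 2 : ℕ) : ℝ) ^ 2) :=
  (summable_nat_add_iff 2 (f := fun k : ℕ => 1 / (k : ℝ) ^ 2)).2
    (Real.summable_one_div_nat_pow.2 (by norm_num))

lemma ft_bound (p : ℝ) (hp : 2 ≤ p) (k : ℕ) (x : ℝ) :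
    ‖ft p (k + 2) x‖ ≤ 2 ^ (2 - p) * (1 / ((k + 2 : ℕ) : ℝ) ^ 2) := by
  refine le_trans ?_ (pow_bound p hp k)
  unfold ft
  rw [norm_div, Real.norm_eq_abs, Real.norm_eq_abs, abs_of_nonneg (by positivity :
    (0 : ℝ) ≤ ((k + 2 : ℕ) : ℝ) ^ (1 + p))]
  gcongr
  refine (Real.abs_sin_le_one _).trans ?_
  push_cast; linarith [k.cast_nonneg (α := ℝ)]

lemma ft'_bound (p : ℝ) (hp : 2 ≤ p) (k : ℕ) (x : ℝ) :
    ‖ft' p (k + 2) x‖ ≤ 2 * π * (2 ^ (2 - p) * (1 / ((k + 2 : ℕ) : ℝ) ^ 2)) := by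
  have h := pow_bound p hp k
  have h2 : ‖ft' p (k + 2) x‖ ≤
      2 * π * (((k + 2 : ℕ) : ℝ) / ((k + 2 : ℕ) : ℝ) ^ (1 + p)) := by
    unfold ft'
    rw [norm_div, norm_mul, Real.norm_eq_abs, Real.norm_eq_abs, Real.norm_eq_abs,
      abs_of_nonneg (by positivity : (0 : ℝ) ≤ ((k + 2 : ℕ) : ℝ) ^ (1 + p)),
      abs_of_nonneg (by positivity : (0 : ℝ) ≤ 2 * π * ((k + 2 : ℕ) : ℝ)), ← mul_div_assoc]
    have := Real.abs_cos_le_one (2 * π * ((k + 2 : ℕ) : ℝ) * x - π * p / 2)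
    refine div_le_div_of_nonneg_right ?_ (by positivity)
    nlinarith [(by positivity : (0 : ℝ) ≤ 2 * π * ((k + 2 : ℕ) : ℝ))]
  refine h2.trans ?_
  gcongr

/-- tail -/
noncomputable def T (p x : ℝ) : ℝ := ∑' k : ℕ, ft p (k + 2) x
/-- derivative of the tail -/
noncomputable def T' (p x : ℝ) : ℝ := ∑' k : ℕ, ft' p (k + 2) x

lemma T_bound (p : ℝ) (hp : 2 ≤ p) (x : ℝ) : |T p x| ≤ 2 ^ (2 - p) * C :=
  tsum_of_norm_bounded (summC.hasSum.mul_left _) (fun k => ft_bound p hp k x)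

lemma T'_bound (p : ℝ) (hp : 2 ≤ p) (x : ℝ) : |T' p x| ≤ 2 * π * (2 ^ (2 - p) * C) :=
  tsum_of_norm_bounded ((summC.hasSum.mul_left _).mul_left _) (fun k => ft'_bound p hp k x)

lemma summT (p : ℝ) (hp : 2 ≤ p) (x : ℝ) : Summable (fun k : ℕ => ft p (k + 2) x) :=
  Summable.of_norm_bounded (summC.mul_left _) (fun k => ft_bound p hp k x)

lemma T_deriv (p : ℝ) (hp : 2 ≤ p) (x : ℝ) : HasDerivAt (T p) (T' p x) x :=
  hasDerivAt_tsum ((summC.mul_left _).mul_left _) (fun k y => ft_hasDerivAt p (k + 2) y)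
    (fun k y => ft'_bound p hp k y) (summT p hp 0) x

lemma hzeta_eq (p : ℝ) (hp : 2 ≤ p) (x : ℝ) :
    hzeta (-p) x = Q p * (Real.sin (2 * π * x - π * p / 2) + T p x) := by
  rw [← (hasSum_hzeta p (by linarith) x).tsum_eq, tsum_mul_left]
  congr 1
  have hs : Summable (fun k => ft p k x) := (summable_nat_add_iff 2).1 (summT p hp x)
  rw [← hs.sum_add_tsum_nat_add 2]
  have : (1 + p) ≠ 0 := by linarith
  simp [Finset.sum_range_succ, ft, T, Real.zero_rpow this]

/-- Truncated power sum. -/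
noncomputable def S (q : ℝ) (N : ℕ) (a : ℝ) : ℝ :=
  ∑ j ∈ Finset.range N, (max (a - (j + 1 : ℕ)) 0) ^ q

lemma S_bound (q : ℝ) (hq : 1 < q) (N : ℕ) (a : ℝ) (ha : 0 ≤ a) :
    q * S (q - 1) N a ≤ a ^ q := by
  have key : ∀ j : ℕ, q * (max (a - (j + 1 : ℕ)) 0) ^ (q - 1) ≤
      (max (a - (j : ℕ)) 0) ^ q - (max (a - (j + 1 : ℕ)) 0) ^ q := by
    intro j
    rcases le_or_gt (a - (j + 1 : ℕ)) 0 with h | h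
    · rw [max_eq_right h, Real.zero_rpow (by linarith), Real.zero_rpow (by linarith)]
      have : 0 ≤ (max (a - (j : ℕ)) 0) ^ q := by positivity
      linarith
    · rw [max_eq_left h.le]
      set y := a - (j + 1 : ℕ) with hy
      have e : a - (j : ℕ) = y + 1 := by rw [hy]; push_cast; ring
      rw [e, max_eq_left (by linarith)]
      have hb := one_add_mul_self_le_rpow_one_add (s := 1 / y) (by
        have : 0 < 1 / y := by positivity
        linarith) hq.le
      have e2 : y + 1 = y * (1 + 1 / y) := by field_simp
      rw [e2, Real.mul_rpow h.le (by positivity), Real.rpow_sub h, Real.rpow_one]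
      have hyq : 0 < y ^ q := by positivity
      have := mul_le_mul_of_nonneg_left hb hyq.le
      have e3 : y ^ q * (1 + q * (1 / y)) = y ^ q + q * (y ^ q / y) := by field_simp
      linarith
  unfold S
  rw [Finset.mul_sum]
  refine (Finset.sum_le_sum fun j _ => key j).trans ?_
  rw [Finset.sum_range_sub' (fun j : ℕ => (max (a - (j : ℕ)) 0) ^ q)]
  have : 0 ≤ (max (a - (N : ℕ)) 0) ^ q := by positivity
  simp only [Nat.cast_zero, sub_zero, max_eq_left ha]
  linarith

lemma S_nonneg (q : ℝ) (N : ℕ) (a : ℝ) : 0 ≤ S q N a :=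
  Finset.sum_nonneg fun j _ => by positivity

lemma max_deriv (p : ℝ) (hp : 1 < p) (x : ℝ) :
    HasDerivAt (fun x : ℝ => (max x 0) ^ p) (p * (max x 0) ^ (p - 1)) x := by
  rcases lt_trichotomy x 0 with h | h | h
  · rw [max_eq_right h.le, Real.zero_rpow (by linarith), mul_zero]
    refine (hasDerivAt_const x (0 : ℝ)).congr_of_eventuallyEq ?_
    filter_upwards [gt_mem_nhds h] with y hy
    rw [max_eq_right (le_of_lt hy), Real.zero_rpow (by linarith)]
  · subst h
    rw [max_self, Real.zero_rpow (by linarith), mul_zero]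
    have h0 := Real.hasDerivAt_rpow_const (x := 0) (p := p) (Or.inr hp.le)
    rw [Real.zero_rpow (by linarith), mul_zero] at h0
    rw [hasDerivAt_iff_isLittleO] at h0 ⊢
    refine Asymptotics.IsBigO.trans_isLittleO ?_ h0
    refine Asymptotics.IsBigO.of_bound 1 (Filter.Eventually.of_forall fun y => ?_)
    simp only [max_self, Real.zero_rpow (by linarith : p ≠ 0), sub_zero, smul_zero, one_mul]
    rcases le_total y 0 with hy | hy
    · rw [max_eq_right hy, Real.zero_rpow (by linarith)]; simp
    · rw [max_eq_left hy]
  · rw [max_eq_left h.le]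
    refine (Real.hasDerivAt_rpow_const (Or.inl h.ne')).congr_of_eventuallyEq ?_
    filter_upwards [lt_mem_nhds h] with y hy
    rw [max_eq_left (le_of_lt hy)]

lemma S_deriv (p : ℝ) (hp : 1 < p) (N : ℕ) (a : ℝ) :
    HasDerivAt (S p N) (p * S (p - 1) N a) a := by
  unfold S
  rw [Finset.mul_sum]
  refine HasDerivAt.fun_sum fun j _ => ?_
  have := (max_deriv p hp (a - (j + 1 : ℕ))).comp_sub_const a ((j + 1 : ℕ) : ℝ)
  exact this

lemma zetaH_eq (p : ℝ) (hp : 2 ≤ p) (N : ℕ) (a : ℝ) (ha : 0 < a) (hN : a ≤ N) :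
    zetaH p a = Q p * (Real.sin (2 * π * a - π * p / 2) + T p a) - S p N a := by
  unfold zetaH
  have hc : ((a - (⌈a⌉₊ - 1 : ℕ) : ℝ) : UnitAddCircle) = (a : UnitAddCircle) := by
    have h0 : (((⌈a⌉₊ - 1 : ℕ) : ℝ) : UnitAddCircle) = 0 :=
      (AddCircle.coe_eq_zero_iff (1 : ℝ)).2 ⟨((⌈a⌉₊ - 1 : ℕ) : ℤ), by simp⟩
    rw [AddCircle.coe_sub, h0, sub_zero]
  have h1 : hzeta (-p) (a - (⌈a⌉₊ - 1 : ℕ)) = hzeta (-p) a := by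
    unfold hzeta; rw [hc]
  rw [h1, hzeta_eq p hp]
  congr 1
  have hpos : 0 < ⌈a⌉₊ := Nat.ceil_pos.2 ha
  have hle : ⌈a⌉₊ - 1 ≤ N := by
    have : ⌈a⌉₊ ≤ N := Nat.ceil_le.2 hN
    omega
  unfold S
  rw [← Finset.sum_range_reflect]
  have hsub := Finset.sum_subset (f := fun j : ℕ => (max (a - (j + 1 : ℕ)) 0) ^ p)
    (Finset.range_subset_range.2 hle) (by
      intro j _ hj
      have hj : ⌈a⌉₊ ≤ j + 1 := by
        rw [Finset.mem_range, not_lt] at hj; omega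
      have : a ≤ (j + 1 : ℕ) := Nat.ceil_le.1 hj
      rw [max_eq_right (by linarith), Real.zero_rpow (by linarith)])
  rw [← hsub]
  refine Finset.sum_congr rfl fun j hj => ?_
  rw [Finset.mem_range] at hj
  have hj2 : j + 1 < ⌈a⌉₊ := by omega
  have hlt : ((j + 1 : ℕ) : ℝ) < a := Nat.lt_ceil.1 hj2
  rw [max_eq_left (by linarith)]
  congr 1
  have : ⌈a⌉₊ - 1 = (⌈a⌉₊ - 1 - 1 - j) + (j + 1) := by omega
  have e : ((⌈a⌉₊ - 1 : ℕ) : ℝ) = ((⌈a⌉₊ - 1 - 1 - j : ℕ) : ℝ) + ((j + 1 : ℕ) : ℝ) := by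
    exact_mod_cast this
  rw [e]; ring

lemma zetaH_deriv (p : ℝ) (hp : 2 ≤ p) (N : ℕ) (a : ℝ) (ha : 0 < a) (hN : a < N) :
    HasDerivAt (fun x => zetaH p x)
      (Q p * (Real.cos (2 * π * a - π * p / 2) * (2 * π) + T' p a) - p * S (p - 1) N a) a := by
  have h : HasDerivAt (fun x : ℝ => 2 * π * x - π * p / 2) (2 * π) a := by
    simpa using ((hasDerivAt_id a).const_mul (2 * π)).sub_const (π * p / 2)
  have := ((h.sin.add (T_deriv p hp a)).const_mul (Q p)).sub (S_deriv p (by linarith) N a)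
  refine this.congr_of_eventuallyEq ?_
  filter_upwards [lt_mem_nhds ha, gt_mem_nhds hN] with y hy1 hy2
  exact zetaH_eq p hp N y hy1 (le_of_lt hy2)

lemma gamma_lower (p : ℝ) (hp : 2 ≤ p) :
    √(p - 1) * ((p - 1) / Real.exp 1) ^ p ≤ Real.Gamma (1 + p) := by
  set n := ⌊p⌋₊ with hn
  have hn1 : (n : ℝ) ≤ p := Nat.floor_le (by linarith)
  have hn2 : p < n + 1 := Nat.lt_floor_add_one p
  have hn0 : (1 : ℝ) < n := by
    have : 2 ≤ n := Nat.le_floor (by exact_mod_cast hp)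
    have : (2 : ℝ) ≤ n := by exact_mod_cast this
    linarith
  have hfac := Stirling.le_factorial_stirling n
  have hge : (n.factorial : ℝ) * (n : ℝ) ^ (p - n) ≤ Real.Gamma (1 + p) := by
    rcases hn1.eq_or_lt with h | h
    · rw [← h]; simp [add_comm, Real.Gamma_nat_eq_factorial]
    · have := Real.BohrMollerup.f_add_nat_ge (f := Real.log ∘ Real.Gamma) (x := p - n) (n := n + 1)
        Real.convexOn_log_Gamma (by
          intro y hy
          simp only [Function.comp]
          rw [Real.Gamma_add_one hy.ne', Real.log_mul hy.ne' (Real.Gamma_pos_of_pos hy).ne',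
            add_comm]) (by
              have : 1 < n := by exact_mod_cast hn0
              omega) (by linarith)
      simp only [Function.comp] at this
      have e1 : ((n + 1 : ℕ) : ℝ) + (p - n) = 1 + p := by push_cast; ring
      have e2 : ((n + 1 : ℕ) : ℝ) - 1 = n := by push_cast; ring
      have e3 : Real.Gamma ((n + 1 : ℕ) : ℝ) = n.factorial := by
        push_cast; exact Real.Gamma_nat_eq_factorial n
      rw [e1, e2, e3, ← Real.log_rpow (by linarith), ← Real.log_mul (by positivity)
        (by positivity)] at this
      exact (Real.log_le_log_iff (by positivity) (Real.Gamma_pos_of_pos (by linarith))).1 this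
  refine le_trans ?_ hge
  have h1 : √(p - 1) ≤ √(2 * π * n) := by
    apply Real.sqrt_le_sqrt
    nlinarith [Real.pi_gt_three]
  have h2 : ((p - 1) / Real.exp 1) ^ p ≤ ((n : ℝ) / Real.exp 1) ^ n * (n : ℝ) ^ (p - n) := by
    calc ((p - 1) / Real.exp 1) ^ p ≤ ((n : ℝ) / Real.exp 1) ^ p := by
          apply Real.rpow_le_rpow
          · apply div_nonneg (by linarith) (by positivity)
          · gcongr; linarith
          · linarith
      _ = ((n : ℝ) / Real.exp 1) ^ n * ((n : ℝ) / Real.exp 1) ^ (p - n) := by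
          rw [← Real.rpow_natCast, ← Real.rpow_add (by positivity)]; congr 1; ring
      _ ≤ _ := by
          refine mul_le_mul_of_nonneg_left ?_ (by positivity)
          refine Real.rpow_le_rpow (by positivity) ?_ (by linarith)
          apply div_le_self (by linarith)
          exact Real.one_le_exp (by norm_num)
  calc _ ≤ √(2 * π * n) * (((n : ℝ) / Real.exp 1) ^ n * (n : ℝ) ^ (p - n)) := by
        apply mul_le_mul h1 h2 _ (by positivity)
        apply Real.rpow_nonneg
        apply div_nonneg (by linarith) (by positivity)
    _ = (√(2 * π * n) * ((n : ℝ) / Real.exp 1) ^ n) * (n : ℝ) ^ (p - n) := by ring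
    _ ≤ _ := by gcongr

lemma Q_pos (p : ℝ) (hp : 0 < p) : 0 < Q p := by
  unfold Q
  have := Real.Gamma_pos_of_pos (by linarith : 0 < 1 + p)
  positivity

lemma apow_le (p : ℝ) (hp : 2 ≤ p) (a : ℝ) (ha : 0 < a)
    (h : a < (p - 1) / (2 * π * Real.exp 1)) : a ^ p ≤ Q p * (π / √(p - 1)) := by
  have hg := gamma_lower p hp
  have hs : 0 < √(p - 1) := Real.sqrt_pos.2 (by linarith)
  have hq : 0 ≤ (p - 1) / Real.exp 1 := div_nonneg (by linarith) (by positivity)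
  have h2 : a ^ p ≤ ((p - 1) / Real.exp 1) ^ p / (2 * π) ^ p := by
    rw [← Real.div_rpow hq (by positivity)]
    apply Real.rpow_le_rpow ha.le _ (by linarith)
    refine h.le.trans (le_of_eq ?_)
    field_simp
  refine h2.trans ?_
  unfold Q
  rw [Real.rpow_add (by positivity), Real.rpow_one]
  have hP : 0 < (2 * π) ^ p := by positivity
  have e : 2 * Real.Gamma (1 + p) / (2 * π * (2 * π) ^ p) * (π / √(p - 1))
     = (Real.Gamma (1 + p) / √(p - 1)) / (2 * π) ^ p := by
    field_simp
  rw [e]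
  gcongr
  rw [le_div_iff₀ hs]
  linarith

lemma lim : Filter.Tendsto (fun p : ℝ => (2 : ℝ) ^ (2 - p) * C + π / √(p - 1))
    Filter.atTop (nhds 0) := by
  have h1 : Filter.Tendsto (fun p : ℝ => (2 : ℝ) ^ (2 - p)) Filter.atTop (nhds 0) := by
    have := (tendsto_rpow_atBot_of_base_gt_one 2 (by norm_num)).comp
      (Filter.tendsto_atBot_add_const_left Filter.atTop (2 : ℝ) Filter.tendsto_neg_atTop_atBot)
    simpa [Function.comp_def, sub_eq_add_neg] using this
  have h2 : Filter.Tendsto (fun p : ℝ => π / √(p - 1)) Filter.atTop (nhds 0) := by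
    apply Filter.Tendsto.const_div_atTop
    exact Real.tendsto_sqrt_atTop.comp
      (Filter.tendsto_atTop_add_const_right _ (-1 : ℝ) Filter.tendsto_id)
  simpa using (h1.mul_const C).add h2

end Stmt5

open Stmt5 in
theorem stmt_5 (ε : ℝ) (hε : 0 < ε) :
    ∃ P : ℝ, ∀ p : ℝ, P < p → ∀ a : ℝ,
      0 < a → a < (p - 1) / (2 * π * Real.exp 1) → zetaH p a = 0 →
        deriv (fun x => zetaH p x) a ≠ 0 ∧
        ∃ l : ℤ, |a - (p / 4 + (l : ℝ) / 2)| < ε := by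
  have hev := lim.eventually (gt_mem_nhds (lt_min hε (by norm_num : (0 : ℝ) < 1 / 2)))
  obtain ⟨P, hP⟩ := Filter.eventually_atTop.1 (hev.and (Filter.eventually_ge_atTop 2))
  refine ⟨P, fun p hp a ha hap hz => ?_⟩
  obtain ⟨hδ, hp2⟩ := hP p hp.le
  obtain ⟨N, hN⟩ := exists_nat_gt a
  have hQ := Q_pos p (by linarith)
  have hapow := apow_le p hp2 a ha hap
  have hT := T_bound p hp2 a
  have hT' := T'_bound p hp2 a
  have hpi := Real.pi_gt_three
  rw [zetaH_eq p hp2 N a ha hN.le] at hz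
  have hS0 := S_nonneg p N a
  have hS1 := S_nonneg (p - 1) N a
  have hS1' := S_bound p (by linarith) N a ha.le
  have hS0' : S p N a ≤ a ^ p := by
    have h := S_bound (p + 1) (by linarith) N a ha.le
    rw [add_sub_cancel_right, Real.rpow_add ha, Real.rpow_one] at h
    have hle : a ≤ p + 1 := by
      have : (p - 1) / (2 * π * Real.exp 1) ≤ p - 1 := by
        apply div_le_self (by linarith)
        have := Real.one_le_exp (x := 1) (by norm_num)
        nlinarith
      linarith
    have h0 : 0 < a ^ p := by positivity
    have : (p + 1) * S p N a ≤ (p + 1) * a ^ p := by nlinarith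
    exact le_of_mul_le_mul_left this (by linarith)
  set τ := (2 : ℝ) ^ (2 - p) * C
  set η := π / √(p - 1)
  set θ := 2 * π * a - π * p / 2 with hθ
  have hη : 0 ≤ η := by positivity
  have hsin : |Real.sin θ| ≤ τ + η := by
    have h1 : Real.sin θ + T p a ≤ η := by
      refine le_of_mul_le_mul_left (a := Q p) ?_ hQ
      linarith
    have h2 : 0 ≤ Real.sin θ + T p a := by
      by_contra hc
      push Not at hc
      nlinarith
    rw [abs_le] at hT ⊢
    constructor <;> linarith
  constructor
  · rw [(zetaH_deriv p hp2 N a ha hN).deriv]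
    intro hd
    have h1 : Real.cos θ * (2 * π) + T' p a ≤ η := by
      refine le_of_mul_le_mul_left (a := Q p) ?_ hQ
      linarith
    have h2 : 0 ≤ Real.cos θ * (2 * π) + T' p a := by
      by_contra hc
      push Not at hc
      have : 0 ≤ p * S (p - 1) N a := mul_nonneg (by linarith) hS1
      nlinarith
    have hcos : |Real.cos θ| ≤ τ + η := by
      rw [abs_le] at hT' ⊢
      constructor
      · refine le_of_mul_le_mul_left (a := 2 * π) ?_ (by linarith)
        nlinarith
      · refine le_of_mul_le_mul_left (a := 2 * π) ?_ (by linarith)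
        nlinarith
    have hlt : τ + η < 1 / 2 := lt_of_lt_of_le hδ (min_le_right _ _)
    have hsq := Real.sin_sq_add_cos_sq θ
    rw [← sq_abs (Real.sin θ), ← sq_abs (Real.cos θ)] at hsq
    nlinarith [abs_nonneg (Real.sin θ), abs_nonneg (Real.cos θ)]
  · refine ⟨round (2 * (a - p / 4)), ?_⟩
    set l := round (2 * (a - p / 4)) with hl
    have hr := abs_sub_round (2 * (a - p / 4))
    rw [← hl] at hr
    set x := 2 * (a - p / 4) - l with hx
    have hθx : θ = π * x + l * π := by rw [hθ, hx]; ring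
    have hsx : |Real.sin θ| = |Real.sin (π * x)| := by
      rw [hθx, Real.sin_add_int_mul_pi, abs_mul]
      simp
    have hm := Real.mul_abs_le_abs_sin (x := π * x) (by
      rw [abs_mul, abs_of_pos Real.pi_pos]; nlinarith)
    rw [abs_mul, abs_of_pos Real.pi_pos, ← hsx] at hm
    have e : 2 / π * (π * |x|) = 2 * |x| := by field_simp
    have e2 : a - (p / 4 + (l : ℝ) / 2) = x / 2 := by rw [hx]; ring
    rw [e2, abs_div, abs_two]
    have := lt_of_lt_of_le hδ (min_le_left _ _)
    linarith [abs_nonneg x]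
end

section
/- Let f : ℝ → ℝ be n times continuously differentiable on an open interval (a, b). If the n-th derivative f⁽ⁿ⁾ has constant sign on (a, b) (either f⁽ⁿ⁾(x) > 0 for all x ∈ (a,b), or f⁽ⁿ⁾(x) < 0 for all x ∈ (a,b)), then the set {x ∈ (a, b) : f(x) = 0} has at most n elements. -/
theorem zeros_aux (a b : ℝ) (n : ℕ) : ∀ (f : ℝ → ℝ),
    ContDiffOn ℝ n f (Set.Ioo a b) →
    (∀ x ∈ Set.Ioo a b, iteratedDerivWithin n f (Set.Ioo a b) x ≠ 0) →
    {x ∈ Set.Ioo a b | f x = 0}.Finite ∧ {x ∈ Set.Ioo a b | f x = 0}.ncard ≤ n := by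
  induction n with
  | zero =>
    intro f _ h
    have : {x ∈ Set.Ioo a b | f x = 0} = ∅ := by
      ext x
      simp only [Set.mem_ofPred_eq, Set.mem_empty_iff_false, iff_false, not_and]
      intro hx
      simpa using h x hx
    rw [this]
    simp
  | succ n ih =>
    intro f hf h
    have hf1 : ContDiffOn ℝ n (derivWithin f (Set.Ioo a b)) (Set.Ioo a b) :=
      hf.derivWithin (uniqueDiffOn_Ioo a b) (by norm_cast)
    obtain ⟨hfin, hcard⟩ := ih _ hf1 (by rwa [iteratedDerivWithin_succ'] at h)
    have key : ∀ s : Finset ℝ, (s : Set ℝ) ⊆ {x ∈ Set.Ioo a b | f x = 0} →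
        s.card ≤ n + 1 := by
      intro s hs
      have h2 : s.card ≤ hfin.toFinset.card + 1 := by
        apply Finset.card_le_of_interleaved
        intro x hx y hy hxy _
        obtain ⟨⟨hx1, hx2⟩, hx3⟩ := hs hx
        obtain ⟨⟨hy1, hy2⟩, hy3⟩ := hs hy
        have hsub : Set.Icc x y ⊆ Set.Ioo a b := fun z hz =>
          ⟨hx1.trans_le hz.1, hz.2.trans_lt hy2⟩
        obtain ⟨z, hz, hz0⟩ := exists_deriv_eq_zero hxy (hf.continuousOn.mono hsub)
          (hx3.trans hy3.symm)
        have hzm := hsub (Set.Ioo_subset_Icc_self hz)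
        refine ⟨z, ?_, hz.1, hz.2⟩
        simp only [Set.Finite.mem_toFinset, Set.mem_ofPred_eq]
        exact ⟨hzm, by rw [derivWithin_of_isOpen isOpen_Ioo hzm, hz0]⟩
      rw [← Set.ncard_eq_toFinset_card _ hfin] at h2
      omega
    have hF : {x ∈ Set.Ioo a b | f x = 0}.Finite := by
      by_contra hinf
      obtain ⟨t, ht, htc⟩ := Set.Infinite.exists_subset_card_eq hinf (n + 2)
      have := key t ht
      omega
    refine ⟨hF, ?_⟩
    rw [Set.ncard_eq_toFinset_card _ hF]
    exact key _ (by simp)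

theorem stmt_6 (f : ℝ → ℝ) (n : ℕ) (a b : ℝ) (hab : a < b)
    (hf : ContDiffOn ℝ n f (Set.Ioo a b))
    (hsign : (∀ x ∈ Set.Ioo a b, 0 < iteratedDerivWithin n f (Set.Ioo a b) x) ∨
             (∀ x ∈ Set.Ioo a b, iteratedDerivWithin n f (Set.Ioo a b) x < 0)) :
    {x ∈ Set.Ioo a b | f x = 0}.Finite ∧ {x ∈ Set.Ioo a b | f x = 0}.ncard ≤ n := by
  apply zeros_aux a b n f hf
  intro x hx
  rcases hsign with h | h
  · exact (h x hx).ne'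
  · exact (h x hx).ne
end

section
/- For every real p > 0 and every integer n ≥ 2, one has Σ_{k=1}^{n} k^p < n^p · (1 − e^{−p})/(1 − e^{−p/n}). -/
open Real

theorem stmt_7 (p : ℝ) (hp : 0 < p) (n : ℕ) (hn : 2 ≤ n) :
    ∑ k ∈ Finset.Icc 1 n, (k : ℝ) ^ p <
      (n : ℝ) ^ p * (1 - Real.exp (-p)) / (1 - Real.exp (-p / n)) := by
  have hn0 : (0 : ℝ) < n := by positivity
  have hr : Real.exp (-p / n) < 1 := by
    rw [Real.exp_lt_one_iff]
    exact div_neg_of_neg_of_pos (by linarith) hn0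
  have hgeo : (n : ℝ) ^ p * (1 - Real.exp (-p)) / (1 - Real.exp (-p / n))
      = ∑ k ∈ Finset.Icc 1 n, (n : ℝ) ^ p * Real.exp (-p / n) ^ (n - k) := by
    have h1 : ∑ k ∈ Finset.Icc 1 n, (n : ℝ) ^ p * Real.exp (-p / n) ^ (n - k)
        = ∑ j ∈ Finset.range n, (n : ℝ) ^ p * Real.exp (-p / n) ^ j := by
      refine Finset.sum_nbij' (fun k => n - k) (fun j => n - j) ?_ ?_ ?_ ?_ ?_
      · intro k hk
        simp only [Finset.mem_Icc, Finset.mem_range] at *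
        omega
      · intro k hk
        simp only [Finset.mem_Icc, Finset.mem_range] at *
        omega
      · intro k hk
        simp only [Finset.mem_Icc] at *
        omega
      · intro k hk
        simp only [Finset.mem_range] at *
        omega
      · intro k hk
        rfl
    have h2 : Real.exp (-p / n) ^ n = Real.exp (-p) := by
      rw [← Real.exp_nat_mul]
      congr 1
      field_simp
    rw [h1, ← Finset.mul_sum, geom_sum_eq hr.ne, h2, mul_div_assoc]
    congr 1
    rw [← neg_div_neg_eq, neg_sub, neg_sub]
  have key : ∀ k ∈ Finset.Icc 1 n, (n : ℝ) ^ p * Real.exp (-p / n) ^ (n - k)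
      = ((n : ℝ) * Real.exp ((k : ℝ) / n - 1)) ^ p := by
    intro k hk
    have hk2 := (Finset.mem_Icc.mp hk).2
    rw [Real.mul_rpow hn0.le (Real.exp_pos _).le, ← Real.exp_mul, ← Real.exp_nat_mul,
      Nat.cast_sub hk2]
    congr 2
    field_simp
    ring
  rw [hgeo]
  refine Finset.sum_lt_sum ?_ ⟨1, Finset.mem_Icc.mpr ⟨le_rfl, by omega⟩, ?_⟩
  · intro k hk
    rw [key k hk]
    refine Real.rpow_le_rpow (by positivity) ?_ hp.le
    have h := Real.add_one_le_exp ((k : ℝ) / n - 1)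
    calc (k : ℝ) = n * ((k : ℝ) / n - 1 + 1) := by field_simp; ring
      _ ≤ _ := by gcongr
  · have hk : 1 ∈ Finset.Icc 1 n := Finset.mem_Icc.mpr ⟨le_rfl, by omega⟩
    rw [key 1 hk]
    refine Real.rpow_lt_rpow (by positivity) ?_ hp
    have hn1 : (1 : ℝ) < n := by exact_mod_cast hn
    have hne : ((1 : ℕ) : ℝ) / n - 1 ≠ 0 := by
      have : ((1 : ℕ) : ℝ) / n < 1 := by
        rw [div_lt_one hn0]
        simpa using hn1
      linarith
    have h := Real.add_one_lt_exp hne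
    calc ((1 : ℕ) : ℝ) = n * (((1 : ℕ) : ℝ) / n - 1 + 1) := by field_simp; ring
      _ < _ := by gcongr
end

section
/- For every real p > 4, one has Σ_{r=2}^{∞} r^{−(1+p)} < (π²/6 − 3/4)·2^{−p}. -/
open Real

theorem stmt_8 (p : ℝ) (hp : 4 < p) :
    ∑' r : ℕ, ((r : ℝ) + 2) ^ (-(1 + p)) < (π ^ 2 / 6 - 3 / 4) * 2 ^ (-p) := by
  have h4 : HasSum (fun n : ℕ => 1 / ((n + 2 : ℕ) : ℝ) ^ 4) (π ^ 4 / 90 - 1) := by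
    have h := (hasSum_nat_add_iff' (f := fun n : ℕ => 1 / (n : ℝ) ^ 4) 2).2 hasSum_zeta_four
    simpa [Finset.sum_range_succ] using h
  have hg := h4.mul_left (8 * (2 : ℝ) ^ (-p))
  have hle : ∀ r : ℕ, ((r : ℝ) + 2) ^ (-(1 + p)) ≤
      8 * (2 : ℝ) ^ (-p) * (1 / ((r + 2 : ℕ) : ℝ) ^ 4) := by
    intro r
    have hr : (0 : ℝ) < (r : ℝ) + 2 := by positivity
    have e1 : ((r : ℝ) + 2) ^ (-(1 + p)) = ((r : ℝ) + 2) ^ (3 - p) * (1 / ((r : ℝ) + 2) ^ 4) := by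
      rw [show -(1 + p) = (3 - p) - (4 : ℕ) by push_cast; ring, rpow_sub_natCast hr.ne']
      ring
    have e2 : 8 * (2 : ℝ) ^ (-p) = 2 ^ (3 - p) := by
      rw [show 3 - p = -p + (3 : ℕ) by push_cast; ring, rpow_add_natCast (by norm_num)]
      ring
    rw [e1, e2]
    push_cast
    refine mul_le_mul_of_nonneg_right ?_ (by positivity)
    exact rpow_le_rpow_of_nonpos (by norm_num) (by linarith [(Nat.cast_nonneg r : (0 : ℝ) ≤ r)])
      (by linarith)
  have hs : Summable (fun r : ℕ => ((r : ℝ) + 2) ^ (-(1 + p))) :=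
    Summable.of_nonneg_of_le (fun r => by positivity) hle hg.summable
  have hb := hs.tsum_le_tsum hle hg.summable
  rw [hg.tsum_eq] at hb
  have h2 : (0 : ℝ) < 2 ^ (-p) := by positivity
  have hx : π ^ 2 < 9.9225 := by
    have := pi_lt_d2
    nlinarith [pi_pos]
  have hx0 : 9 < π ^ 2 := by nlinarith [pi_gt_three]
  have hk : 8 * (π ^ 4 / 90 - 1) < π ^ 2 / 6 - 3 / 4 := by
    rw [show π ^ 4 = (π ^ 2) ^ 2 by ring]
    nlinarith
  calc _ ≤ _ := hb
    _ = 8 * (π ^ 4 / 90 - 1) * 2 ^ (-p) := by ring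
    _ < _ := mul_lt_mul_of_pos_right hk h2
end

section
/- For every real p > 4 and every real b ∈ (0,1], one has |hurwitzZeta(−p) b / Q(p) − sin(2πb − πp/2)| < (π²/6 − 3/4)·2^{−p}. -/
open Real HurwitzZeta

lemma key_hasSum (p : ℝ) (hp : 4 < p) (b : ℝ) :
    HasSum (fun n : ℕ => Real.sin (2 * π * b * n - π * p / 2) / (n : ℝ) ^ (1 + p))
      (hzeta (-p) b / Q p) := by
  have hs : 1 < ((1 + p : ℝ) : ℂ).re := by rw [Complex.ofReal_re]; linarith
  have h1 := hasSum_expZeta_of_one_lt_re b hs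
  have h2 := hasSum_expZeta_of_one_lt_re (-b) hs
  have hfe := hurwitzZeta_one_sub (b : UnitAddCircle) (s := ((1 + p : ℝ) : ℂ))
    (by
      intro n h
      have := congrArg Complex.re h
      simp at this
      have h0 : (0 : ℝ) ≤ n := n.cast_nonneg
      linarith)
    (Or.inr (by
      intro h
      have := congrArg Complex.re h
      simp at this
      linarith))
  have hG : 0 < Real.Gamma (1 + p) := Real.Gamma_pos_of_pos (by linarith)
  have hP : 0 < (2 * π) ^ (1 + p) := by positivity
  have hc : ((2 * π : ℂ)) ^ (-((1 + p : ℝ) : ℂ)) * Complex.Gamma ((1 + p : ℝ) : ℂ)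
      = ((Q p / 2 : ℝ) : ℂ) := by
    rw [Complex.Gamma_ofReal, ← Complex.ofReal_neg,
      show (2 * π : ℂ) = ((2 * π : ℝ) : ℂ) by push_cast; rfl,
      ← Complex.ofReal_cpow (by positivity), ← Complex.ofReal_mul, Real.rpow_neg (by positivity), Q]
    congr 1
    field_simp
  have hQ : 0 < Q p := by unfold Q; positivity
  have hsum := ((h1.mul_left (Complex.exp (-π * Complex.I * ((1 + p : ℝ) : ℂ) / 2))).add
    (h2.mul_left (Complex.exp (π * Complex.I * ((1 + p : ℝ) : ℂ) / 2)))).mul_left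
      (((Q p / 2 : ℝ) : ℂ))
  rw [AddCircle.coe_neg, ← hc, ← hfe] at hsum
  have hre := (Complex.hasSum_re hsum).div_const (Q p)
  rw [show (1 : ℂ) - ((1 + p : ℝ) : ℂ) = ((-p : ℝ) : ℂ) by push_cast; ring] at hre
  refine hre.congr_fun ?_
  intro n
  rw [hc, ← Complex.ofReal_natCast, ← Complex.ofReal_cpow (by positivity),
    show Complex.exp (-π * Complex.I * ((1 + p : ℝ) : ℂ) / 2) *
      (Complex.exp (2 * π * Complex.I * b * ((n : ℝ) : ℂ)) / (((n : ℝ) ^ (1 + p) : ℝ) : ℂ)) +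
      Complex.exp (π * Complex.I * ((1 + p : ℝ) : ℂ) / 2) *
      (Complex.exp (2 * π * Complex.I * (-b : ℝ) * ((n : ℝ) : ℂ)) / (((n : ℝ) ^ (1 + p) : ℝ) : ℂ))
      = ((2 * Real.sin (2 * π * b * n - π * p / 2) / (n : ℝ) ^ (1 + p) : ℝ) : ℂ) from ?_]
  · rw [← Complex.ofReal_mul, Complex.ofReal_re]
    field_simp
  · have e : Real.sin (2 * π * b * n - π * p / 2)
        = Real.cos (2 * π * b * n - π * (1 + p) / 2) := by
      rw [← Real.cos_sub_pi_div_two]; congr 1; ring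
    rw [e, mul_div_assoc', mul_div_assoc', ← add_div, ← Complex.exp_add, ← Complex.exp_add,
      Complex.ofReal_div, Complex.ofReal_mul, Complex.ofReal_cos, Complex.ofReal_ofNat,
      Complex.two_cos]
    congr 3 <;> congr 1 <;> push_cast <;> ring

lemma term_bound (p : ℝ) (hp : 4 < p) (n : ℕ) (hn : 3 ≤ n) :
    1 / (n : ℝ) ^ (1 + p) < 2 ^ (-p) * (1 / (n : ℝ) ^ 2) := by
  have hn3 : (3 : ℝ) ≤ n := by exact_mod_cast hn
  have h0 : (0 : ℝ) < n := by linarith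
  have h1 : (n : ℝ) * 2 ^ p < (n : ℝ) ^ p := by
    have e : (n : ℝ) ^ p = 2 ^ p * ((n : ℝ) / 2) ^ p := by
      rw [← Real.mul_rpow (by norm_num) (by positivity)]; congr 1; ring
    have h4 : ((n : ℝ) / 2) ^ (4 : ℝ) < ((n : ℝ) / 2) ^ p :=
      Real.rpow_lt_rpow_of_exponent_lt (by linarith) hp
    have h5 : (n : ℝ) ≤ ((n : ℝ) / 2) ^ (4 : ℝ) := by
      rw [show (4 : ℝ) = ((4 : ℕ) : ℝ) by norm_num, Real.rpow_natCast]
      have : (16 : ℝ) ≤ (n : ℝ) ^ 3 := by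
        have : (3 : ℝ) ^ 3 ≤ (n : ℝ) ^ 3 := by gcongr
        linarith
      nlinarith
    have h6 : (0 : ℝ) < 2 ^ p := by positivity
    rw [e, mul_comm]
    exact mul_lt_mul_of_pos_left (by linarith) h6
  rw [Real.rpow_neg (by norm_num), Real.rpow_add h0, Real.rpow_one, ← one_div,
    one_div_mul_one_div]
  apply one_div_lt_one_div_of_lt (by positivity)
  nlinarith

theorem stmt_10 (p : ℝ) (hp : 4 < p) (b : ℝ) (hb0 : 0 < b) (hb1 : b ≤ 1) :
    |hzeta (-p) b / Q p - Real.sin (2 * π * b - π * p / 2)| <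
      (π ^ 2 / 6 - 3 / 4) * 2 ^ (-p) := by
  have hf := (key_hasSum p hp b).update 1 0
  have hg := ((hasSum_zeta_two.update 1 0).update 2 (1 / 2)).mul_left ((2 : ℝ) ^ (-p))
  set f := Function.update
    (fun n : ℕ => Real.sin (2 * π * b * n - π * p / 2) / (n : ℝ) ^ (1 + p)) 1 0 with hfdef
  set g : ℕ → ℝ := fun n => (2 : ℝ) ^ (-p) *
    Function.update (Function.update (fun n : ℕ => 1 / (n : ℝ) ^ 2) 1 0) 2 (1 / 2) n with hgdef
  have hpos : (0 : ℝ) < 2 ^ (-p) := by positivity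
  have hsin (n : ℕ) : |Real.sin (2 * π * b * n - π * p / 2) / (n : ℝ) ^ (1 + p)|
      ≤ 1 / (n : ℝ) ^ (1 + p) := by
    rw [abs_div, abs_of_nonneg (a := (n : ℝ) ^ (1 + p)) (by positivity)]
    gcongr
    exact Real.abs_sin_le_one _
  have hlt (n : ℕ) (hn : 3 ≤ n) : |f n| < g n := by
    have a1 : n ≠ 1 := by omega
    have a2 : n ≠ 2 := by omega
    simp only [hfdef, hgdef, Function.update_of_ne a1, Function.update_of_ne a2]
    exact (hsin n).trans_lt (term_bound p hp n hn)
  have hle : ∀ n, |f n| ≤ g n := by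
    intro n
    rcases lt_or_ge n 3 with h | h
    · interval_cases n
      · have : (1 + p) ≠ 0 := by linarith
        simp [hfdef, hgdef, Real.zero_rpow this]
      · simp [hfdef, hgdef]
      · simp only [hfdef, hgdef, Function.update_self]
        rw [Function.update_of_ne (by norm_num)]
        refine (hsin 2).trans (le_of_eq ?_)
        push_cast
        rw [Real.rpow_neg (by norm_num), Real.rpow_add (by norm_num), Real.rpow_one]
        field_simp
    · exact (hlt n h).le
  have hsf : Summable (fun n => |f n|) :=
    Summable.of_nonneg_of_le (fun n => abs_nonneg _) hle hg.summable
  have h3 := hasSum_lt (i := 3) hle (hlt 3 le_rfl) hsf.hasSum hg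
  have h4 : |∑' n, f n| ≤ ∑' n, |f n| := by
    simpa [Real.norm_eq_abs] using norm_tsum_le_tsum_norm (f := f) (by simpa using hsf)
  rw [hf.tsum_eq] at h4
  have h5 := h4.trans_lt h3
  rw [Function.update_of_ne (by norm_num)] at h5
  norm_num at h5
  rw [neg_add_eq_sub] at h5
  refine h5.trans_eq ?_
  generalize (2 : ℝ) ^ (-p) = x
  ring
end

section
/- For every real p > 0 and every real x with 0 < x < 1, the function x ↦ hurwitzZeta(−p) x is differentiable at x with derivative p · hurwitzZeta(1−p) x; that is, ∂/∂x ζ(s, x) = −s·ζ(s+1, x) holds at s = −p for x ∈ (0,1). -/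
open Real HurwitzZeta

lemma cpow_add_one_aux {x : ℂ} (y : ℂ) (hx : x ≠ 0) : x ^ (y + 1) = x ^ y * x := by
  rw [Complex.cpow_add _ _ hx, Complex.cpow_one]

/-- Differences of consecutive terms. -/
noncomputable def ddz (n : ℕ) (s : ℂ) : ℂ := ((n + 2 : ℕ) : ℂ) ^ (-s) - ((n + 1 : ℕ) : ℂ) ^ (-s)

/-- Additive character. -/
noncomputable def eez (a : ℝ) (n : ℕ) : ℂ := Complex.exp (2 * π * Complex.I * a * n)

lemma norm_eez (a : ℝ) (n : ℕ) : ‖eez a n‖ = 1 := by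
  have : (2 * π * Complex.I * a * n : ℂ) = ((2 * π * a * n : ℝ) : ℂ) * Complex.I := by
    push_cast; ring
  rw [eez, this, Complex.norm_exp_ofReal_mul_I]

lemma eez_add (a : ℝ) (m n : ℕ) : eez a (m + n) = eez a m * eez a n := by
  rw [eez, eez, eez, ← Complex.exp_add]; congr 1; push_cast; ring

lemma norm_ddz_le (n : ℕ) {s : ℂ} (hs : 0 < s.re) :
    ‖ddz n s‖ ≤ ‖s‖ * ((n + 1 : ℕ) : ℝ) ^ (-s.re - 1) := by
  have hs0 : -s ≠ 0 := by
    intro h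
    have : s = 0 := by simpa using h
    simp [this] at hs
  have hpos : (0 : ℝ) < ((n + 1 : ℕ) : ℝ) := by positivity
  have key := (convex_Icc (((n + 1 : ℕ) : ℝ)) ((n + 2 : ℕ) : ℝ)).norm_image_sub_le_of_norm_hasDerivWithin_le
    (f := fun t : ℝ => (t : ℂ) ^ (-s)) (f' := fun t : ℝ => -s * (t : ℂ) ^ (-s - 1))
    (C := ‖s‖ * ((n + 1 : ℕ) : ℝ) ^ (-s.re - 1)) (x := ((n + 1 : ℕ) : ℝ)) (y := ((n + 2 : ℕ) : ℝ))
    (fun t ht => (hasDerivAt_ofReal_cpow_const (hpos.trans_le ht.1).ne' hs0).hasDerivWithinAt)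
    (fun t ht => by
      rw [norm_mul, norm_neg, Complex.norm_cpow_eq_rpow_re_of_pos (hpos.trans_le ht.1)]
      gcongr
      simp only [Complex.sub_re, Complex.neg_re, Complex.one_re]
      exact Real.rpow_le_rpow_of_nonpos hpos ht.1 (by linarith))
    (by simp) (by simp)
  have h1 : ‖(((n + 2 : ℕ) : ℝ) - ((n + 1 : ℕ) : ℝ))‖ = 1 := by
    push_cast; norm_num
  rw [h1, mul_one] at key
  simpa [ddz] using key

lemma summable_shift {r : ℝ} (hr : r < -1) : Summable (fun n : ℕ => ((n + 1 : ℕ) : ℝ) ^ r) :=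
  (summable_nat_add_iff (f := fun n : ℕ => (n : ℝ) ^ r) 1).mpr (Real.summable_nat_rpow.mpr hr)

lemma summable_ddz (a : ℝ) {s : ℂ} (hs : 0 < s.re) :
    Summable (fun n : ℕ => eez a (n + 2) * ddz n s) := by
  refine Summable.of_norm_bounded ((summable_shift (r := -s.re - 1) (by linarith)).mul_left ‖s‖) ?_
  intro n
  rw [norm_mul, norm_eez, one_mul]
  exact norm_ddz_le n hs

lemma differentiableOn_G (a : ℝ) :
    DifferentiableOn ℂ (fun s => ∑' n : ℕ, eez a (n + 2) * ddz n s) {s : ℂ | 0 < s.re} := by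
  intro s hs
  have hs' : 0 < s.re := hs
  set U : Set ℂ := {z | s.re / 2 < z.re} ∩ Metric.ball 0 (‖s‖ + 1) with hU
  have hUo : IsOpen U :=
    (isOpen_lt continuous_const Complex.continuous_re).inter Metric.isOpen_ball
  have hsU : s ∈ U := by
    refine ⟨?_, ?_⟩
    · change s.re / 2 < s.re
      linarith
    · simp
  refine DifferentiableAt.differentiableWithinAt ?_
  refine DifferentiableOn.differentiableAt (s := U) ?_ (hUo.mem_nhds hsU)
  refine Complex.differentiableOn_tsum_of_summable_norm
    (u := fun n : ℕ => (‖s‖ + 1) * ((n + 1 : ℕ) : ℝ) ^ (-(s.re / 2) - 1))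
    ((summable_shift (by linarith)).mul_left _) ?_ hUo ?_
  · intro n z hz
    refine DifferentiableAt.differentiableWithinAt ?_
    refine DifferentiableAt.const_mul ?_ _
    unfold ddz
    refine DifferentiableAt.sub ?_ ?_
    · exact differentiableAt_id.neg.const_cpow (Or.inl (Nat.cast_ne_zero.mpr (by omega)))
    · exact differentiableAt_id.neg.const_cpow (Or.inl (Nat.cast_ne_zero.mpr (by omega)))
  · intro n z hz
    have hz1 : s.re / 2 < z.re := hz.1
    have hz2 : ‖z‖ < ‖s‖ + 1 := by simpa using hz.2
    rw [norm_mul, norm_eez, one_mul]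
    refine (norm_ddz_le n (by linarith)).trans ?_
    gcongr
    · simp

lemma hasSum_expZeta_shift (a : ℝ) {s : ℂ} (hs : 1 < s.re) :
    HasSum (fun n : ℕ => eez a (n + 1) * ((n + 1 : ℕ) : ℂ) ^ (-s)) (expZeta a s) := by
  have h := hasSum_expZeta_of_one_lt_re a hs
  have hs0 : s ≠ 0 := by
    rintro rfl
    simp at hs
    linarith
  rw [← hasSum_nat_add_iff' 1] at h
  simp only [Finset.range_one, Finset.sum_singleton, Nat.cast_zero, Complex.zero_cpow hs0, div_zero,
    sub_zero] at h
  refine h.congr_fun ?_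
  intro n
  rw [Complex.cpow_neg, eez, div_eq_mul_inv]

lemma expZeta_eq_G_of_one_lt (a : ℝ) {s : ℂ} (hs : 1 < s.re) :
    (1 - eez a 1) * expZeta a s = eez a 1 + ∑' n : ℕ, eez a (n + 2) * ddz n s := by
  have h := hasSum_expZeta_shift a hs
  have h1 := (hasSum_nat_add_iff' 1).mpr h
  have h2 := h.mul_left (eez a 1)
  have h3 := h1.sub h2
  have h4 : HasSum (fun n : ℕ => eez a (n + 2) * ddz n s)
      (expZeta a s - eez a 1 - eez a 1 * expZeta a s) := by
    convert! h3 using 1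
    · funext n
      have : eez a (n + 2) = eez a 1 * eez a (n + 1) := by rw [← eez_add]; congr 1; omega
      rw [ddz, mul_sub]
      congr 1
      rw [this]; ring
    · simp
  rw [h4.tsum_eq]; ring

lemma expZeta_eq_G {a : ℝ} (ha : (a : UnitAddCircle) ≠ 0) {s : ℂ} (hs : 0 < s.re) :
    (1 - eez a 1) * expZeta a s = eez a 1 + ∑' n : ℕ, eez a (n + 2) * ddz n s := by
  have hUo : IsOpen {s : ℂ | 0 < s.re} := isOpen_lt continuous_const Complex.continuous_re
  have hf : AnalyticOnNhd ℂ (fun s => (1 - eez a 1) * expZeta a s) {s : ℂ | 0 < s.re} :=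
    (((differentiable_expZeta_of_ne_zero ha).const_mul _).differentiableOn).analyticOnNhd hUo
  have hg : AnalyticOnNhd ℂ (fun s => eez a 1 + ∑' n : ℕ, eez a (n + 2) * ddz n s)
      {s : ℂ | 0 < s.re} := ((differentiableOn_G a).const_add _).analyticOnNhd hUo
  refine hf.eqOn_of_preconnected_of_eventuallyEq hg (convex_halfSpace_re_gt 0).isPreconnected
    (z₀ := 2) (by simp) ?_ hs
  filter_upwards [(isOpen_lt continuous_const Complex.continuous_re).mem_nhds
    (show (2 : ℂ) ∈ {s : ℂ | 1 < s.re} by simp)] with z hz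
  exact expZeta_eq_G_of_one_lt a hz

lemma eez_one_ne {a : ℝ} (ha : (a : UnitAddCircle) ≠ 0) : 1 - eez a 1 ≠ 0 := by
  intro h
  apply ha
  have h1 : eez a 1 = 1 := (sub_eq_zero.mp h).symm
  rw [eez, Complex.exp_eq_one_iff] at h1
  obtain ⟨n, hn⟩ := h1
  have h2 : (a : ℂ) = n := by
    have : (2 * π * Complex.I : ℂ) ≠ 0 := Complex.two_pi_I_ne_zero
    apply mul_left_cancel₀ this
    rw [mul_comm _ (n : ℂ), ← hn]; simp
  have h3 : a = n := by exact_mod_cast h2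
  rw [AddCircle.coe_eq_zero_iff]
  exact ⟨n, by simp [h3]⟩

lemma hasDerivAt_eez (n : ℕ) (a : ℝ) :
    HasDerivAt (fun a : ℝ => eez a n) (2 * π * Complex.I * n * eez a n) a := by
  have h : HasDerivAt (fun a : ℝ => (2 * π * Complex.I * a * n : ℂ)) (2 * π * Complex.I * n) a := by
    have := ((Complex.ofRealCLM.hasDerivAt (x := a)).const_mul (2 * π * Complex.I)).mul_const (n : ℂ)
    simpa using this
  have := h.cexp
  refine this.congr_deriv ?_
  rw [eez, mul_comm]

lemma ddz_succ (n : ℕ) (p : ℂ) :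
    ((n + 2 : ℕ) : ℂ) * ddz n (p + 1) = ddz n p - ((n + 1 : ℕ) : ℂ) ^ (-(p + 1)) := by
  have h1 : ((n + 2 : ℕ) : ℂ) ≠ 0 := Nat.cast_ne_zero.mpr (by omega)
  have h2 : ((n + 1 : ℕ) : ℂ) ≠ 0 := Nat.cast_ne_zero.mpr (by omega)
  have e1 : ((n + 2 : ℕ) : ℂ) ^ (-p) = ((n + 2 : ℕ) : ℂ) ^ (-(p + 1)) * ((n + 2 : ℕ) : ℂ) := by
    rw [← cpow_add_one_aux _ h1]; congr 1; ring
  have e2 : ((n + 1 : ℕ) : ℂ) ^ (-p) = ((n + 1 : ℕ) : ℂ) ^ (-(p + 1)) * ((n + 1 : ℕ) : ℂ) := by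
    rw [← cpow_add_one_aux _ h2]; congr 1; ring
  rw [ddz, ddz, e1, e2]
  push_cast
  ring

lemma hasDerivAt_G {p : ℝ} (hp : 0 < p) (a : ℝ) :
    HasDerivAt (fun a : ℝ => eez a 1 + ∑' n : ℕ, eez a (n + 2) * ddz n (p + 1))
      (2 * π * Complex.I * (eez a 1 + (∑' n : ℕ, eez a (n + 2) * ddz n p)
        - eez a 1 * expZeta a (p + 1))) a := by
  have hp1 : 0 < ((p : ℂ) + 1).re := by simp; linarith
  have hp2 : 1 < ((p : ℂ) + 1).re := by simp; linarith
  have hp0 : 0 < ((p : ℂ)).re := by simpa using hp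
  have hder := hasDerivAt_tsum
    (u := fun n : ℕ => (4 * π * ‖(p : ℂ) + 1‖) * ((n + 1 : ℕ) : ℝ) ^ (-p - 1))
    (g := fun (n : ℕ) (a : ℝ) => eez a (n + 2) * ddz n (p + 1))
    (g' := fun (n : ℕ) (a : ℝ) =>
      2 * π * Complex.I * ((n + 2 : ℕ) : ℂ) * eez a (n + 2) * ddz n (p + 1))
    (y₀ := a) ((summable_shift (by linarith)).mul_left _)
    (fun n y => (hasDerivAt_eez (n + 2) y).mul_const _)
    (fun n y => by
      have hb := norm_ddz_le n hp1
      have hpos : (0 : ℝ) < ((n + 1 : ℕ) : ℝ) := by positivity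
      have hn : ‖((n + 2 : ℕ) : ℂ)‖ ≤ 2 * ((n + 1 : ℕ) : ℝ) := by
        rw [Complex.norm_natCast]; push_cast; linarith [Nat.cast_nonneg (α := ℝ) n]
      have hr : ((n + 1 : ℕ) : ℝ) ^ (-p - 1)
          = ((n + 1 : ℕ) : ℝ) ^ (-((p : ℂ) + 1).re - 1) * ((n + 1 : ℕ) : ℝ) := by
        rw [← Real.rpow_add_one hpos.ne']; congr 1; simp; ring
      have h2 : ‖(2 * π * Complex.I : ℂ)‖ = 2 * π := by
        simp [abs_of_pos Real.pi_pos]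
      rw [norm_mul, norm_mul, norm_mul, norm_eez, mul_one, h2, hr]
      calc 2 * π * ‖((n + 2 : ℕ) : ℂ)‖ * ‖ddz n (p + 1)‖
          ≤ 2 * π * (2 * ((n + 1 : ℕ) : ℝ)) *
            (‖(p : ℂ) + 1‖ * ((n + 1 : ℕ) : ℝ) ^ (-((p : ℂ) + 1).re - 1)) := by gcongr
        _ = _ := by ring)
    (summable_ddz a hp1) a
  have hsum := (hasSum_expZeta_shift a hp2).mul_left (eez a 1)
  have hs2 := ((summable_ddz a hp0).hasSum.sub hsum).mul_left (2 * π * Complex.I)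
  convert! (hasDerivAt_eez 1 a).add hder using 1
  have hterm : (fun n : ℕ => 2 * π * Complex.I * ((n + 2 : ℕ) : ℂ) * eez a (n + 2) * ddz n (p + 1))
      = fun n : ℕ => 2 * π * Complex.I * (eez a (n + 2) * ddz n p
        - eez a 1 * (eez a (n + 1) * ((n + 1 : ℕ) : ℂ) ^ (-((p : ℂ) + 1)))) := by
    funext n
    have : eez a (n + 2) = eez a 1 * eez a (n + 1) := by rw [← eez_add]; congr 1; omega
    have h := ddz_succ n p
    rw [← mul_assoc (eez a 1), ← this, ← mul_sub, ← h]
    ring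
  rw [hterm, hs2.tsum_eq]
  push_cast
  ring

lemma hasDerivAt_expZeta {p : ℝ} (hp : 0 < p) {a : ℝ} (ha : (a : UnitAddCircle) ≠ 0) :
    HasDerivAt (fun a : ℝ => expZeta (a : UnitAddCircle) (p + 1))
      (2 * π * Complex.I * expZeta a p) a := by
  have hp1 : 0 < ((p : ℂ) + 1).re := by simp; linarith
  have hp0 : 0 < ((p : ℂ)).re := by simpa using hp
  have hne := eez_one_ne ha
  have h := (hasDerivAt_G hp a).div ((hasDerivAt_eez 1 a).const_sub 1) hne
  have hev : (fun a : ℝ => expZeta (a : UnitAddCircle) (p + 1)) =ᶠ[nhds a]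
      (fun a : ℝ => eez a 1 + ∑' n : ℕ, eez a (n + 2) * ddz n (p + 1)) / fun a => 1 - eez a 1 := by
    have hc : Continuous (fun a : ℝ => (a : UnitAddCircle)) := AddCircle.continuous_mk' 1
    filter_upwards [hc.continuousAt.eventually_ne ha] with b hb
    rw [Pi.div_apply, eq_div_iff (eez_one_ne hb), ← expZeta_eq_G hb hp1]
    ring
  refine (h.congr_of_eventuallyEq hev).congr_deriv ?_
  rw [← expZeta_eq_G ha hp0, ← expZeta_eq_G ha hp1, div_eq_iff (pow_ne_zero 2 hne)]
  push_cast
  ring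

lemma ne_neg_nat {q : ℝ} (hq : 0 < q) (n : ℕ) : (q : ℂ) ≠ -n := by
  intro h
  have : q = -n := by exact_mod_cast h
  have := Nat.cast_nonneg (α := ℝ) n
  linarith

theorem stmt_11 (p : ℝ) (hp : 0 < p) (x : ℝ) (hx0 : 0 < x) (hx1 : x < 1) :
    HasDerivAt (fun y : ℝ => hzeta (-p) y) (p * hzeta (1 - p) x) x := by
  have hx : (x : UnitAddCircle) ≠ 0 := by
    intro h
    rw [AddCircle.coe_eq_zero_iff] at h
    obtain ⟨n, hn⟩ := h
    have hn' : (n : ℝ) = x := by simpa using hn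
    rw [← hn'] at hx0 hx1
    have a1 : 0 < n := by exact_mod_cast hx0
    have a2 : n < 1 := by exact_mod_cast hx1
    omega
  have hnx : ((-x : ℝ) : UnitAddCircle) ≠ 0 := by
    rw [AddCircle.coe_neg]; exact neg_ne_zero.mpr hx
  have hfun : ∀ y : ℝ, hurwitzZeta (y : UnitAddCircle) ((-p : ℝ) : ℂ) =
      (2 * π) ^ (-((p : ℂ) + 1)) * Complex.Gamma (p + 1) *
      (Complex.exp (-π * Complex.I * (p + 1) / 2) * expZeta y (p + 1)
        + Complex.exp (π * Complex.I * (p + 1) / 2) * expZeta ((-y : ℝ) : UnitAddCircle) (p + 1)) := by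
    intro y
    rw [AddCircle.coe_neg, ← hurwitzZeta_one_sub]
    · congr 1; push_cast; ring
    · intro n
      have := ne_neg_nat (q := p + 1) (by linarith) n
      push_cast at this
      exact this
    · right
      intro h
      have : (p : ℂ) = 0 := by simpa using h
      exact hp.ne' (by exact_mod_cast this)
  have hval : hurwitzZeta (x : UnitAddCircle) ((1 - p : ℝ) : ℂ) =
      (2 * π) ^ (-(p : ℂ)) * Complex.Gamma p *
      (Complex.exp (-π * Complex.I * p / 2) * expZeta x p
        + Complex.exp (π * Complex.I * p / 2) * expZeta ((-x : ℝ) : UnitAddCircle) p) := by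
    rw [AddCircle.coe_neg, ← hurwitzZeta_one_sub _ (ne_neg_nat hp) (Or.inl hx)]
    congr 1; push_cast; ring
  have hd1 := hasDerivAt_expZeta hp hx
  have hd2 := (hasDerivAt_expZeta hp hnx).scomp x (hasDerivAt_neg x)
  have hd := (((hd1.const_mul (Complex.exp (-π * Complex.I * (p + 1) / 2))).add
    (hd2.const_mul (Complex.exp (π * Complex.I * (p + 1) / 2)))).const_mul
      ((2 * π) ^ (-((p : ℂ) + 1)) * Complex.Gamma (p + 1)))
  have hC : HasDerivAt (fun y : ℝ => hurwitzZeta (y : UnitAddCircle) ((-p : ℝ) : ℂ))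
      (p * hurwitzZeta (x : UnitAddCircle) ((1 - p : ℝ) : ℂ)) x := by
    have hd' := hd.congr_of_eventuallyEq (f₁ := fun y : ℝ =>
      hurwitzZeta (y : UnitAddCircle) ((-p : ℝ) : ℂ)) (Filter.Eventually.of_forall hfun)
    refine hd'.congr_deriv ?_
    have hpi : (2 * π : ℂ) ≠ 0 := by
      have := Real.pi_ne_zero
      exact_mod_cast mul_ne_zero two_ne_zero this
    have hp' : (p : ℂ) ≠ 0 := by exact_mod_cast hp.ne'
    have e1 : (2 * π : ℂ) ^ (-(p : ℂ)) = (2 * π : ℂ) ^ (-((p : ℂ) + 1)) * (2 * π) := by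
      rw [← cpow_add_one_aux _ hpi]; congr 1; ring
    have e2 : Complex.exp (-π * Complex.I * (p + 1) / 2)
        = Complex.exp (-π * Complex.I * p / 2) * (-Complex.I) := by
      rw [← Complex.exp_neg_pi_div_two_mul_I, ← Complex.exp_add]; congr 1; ring
    have e3 : Complex.exp (π * Complex.I * (p + 1) / 2)
        = Complex.exp (π * Complex.I * p / 2) * Complex.I := by
      have h := Complex.exp_add (π * Complex.I * p / 2) (π / 2 * Complex.I)
      rw [Complex.exp_pi_div_two_mul_I] at h
      rw [← h]; congr 1; ring
    rw [hval, Complex.Gamma_add_one _ hp', e1, e2, e3, neg_one_smul]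
    ring_nf
    rw [Complex.I_sq]
    ring
  have hre := Complex.reCLM.hasFDerivAt.comp_hasDerivAt x hC
  refine hre.congr_deriv ?_
  simp [hzeta]
end
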